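/- Let (T,A) be a locally constant integral uniform cocycle with compact adapted set Θ such that every line J ∈ J(Θ) satisfies J ∩ E^{cs}(x) = ∅ for almost every x. Then for every line L ⊂ ℝ^p parallel to some element of Θ, the intersection L ∩ W^s(x) is contained in ℤ^p for almost every x ∈ Δ, where W^s(x) = {w ∈ ℝ^p : ‖A_n(x)·w‖_{ℝ^p/ℤ^p} → 0} is the weak-stable space. -/

import Mathlib

open MeasureTheory Filter Metric
open scoped BigOperators ENNReal

/-- `‖B‖₀ = max (‖B‖, ‖B⁻¹‖)` (operator norms). -/
noncomputable def norm0 {p : ℕ}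
    (e : EuclideanSpace ℝ (Fin p) ≃L[ℝ] EuclideanSpace ℝ (Fin p)) : ℝ :=
  max ‖(e : EuclideanSpace ℝ (Fin p) →L[ℝ] EuclideanSpace ℝ (Fin p))‖
    ‖(e.symm : EuclideanSpace ℝ (Fin p) →L[ℝ] EuclideanSpace ℝ (Fin p))‖

/-- The cocycle iterates `A_n(x) = A(T^{n-1} x) ⋯ A(x)`. -/
noncomputable def cocycleIter {α : Type*} {p : ℕ} (T : α → α)
    (A : α → (EuclideanSpace ℝ (Fin p) ≃L[ℝ] EuclideanSpace ℝ (Fin p))) :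
    ℕ → α → (EuclideanSpace ℝ (Fin p) ≃L[ℝ] EuclideanSpace ℝ (Fin p))
  | 0, _ => ContinuousLinearEquiv.refl ℝ (EuclideanSpace ℝ (Fin p))
  | n + 1, x => (A x).trans (cocycleIter T A n (T x))

/-- The central stable space `E^{cs}(x)`. -/
noncomputable def centralStable {α : Type*} {p : ℕ} (T : α → α)
    (A : α → (EuclideanSpace ℝ (Fin p) ≃L[ℝ] EuclideanSpace ℝ (Fin p))) (x : α) :
    Set (EuclideanSpace ℝ (Fin p)) :=
  {w | limsup (fun n : ℕ => ‖cocycleIter T A n x w‖ ^ ((1 : ℝ) / n)) atTop ≤ 1}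

/-- The integer lattice `ℤ^p ⊂ ℝ^p`. -/
def latticeZ (p : ℕ) : Set (EuclideanSpace ℝ (Fin p)) := {w | ∀ i, ∃ k : ℤ, w i = (k : ℝ)}

/-- The weak-stable space `W^s(x) = {w : ‖A_n(x)·w‖_{ℝ^p/ℤ^p} → 0}`. -/
noncomputable def weakStable {α : Type*} {p : ℕ} (T : α → α)
    (A : α → (EuclideanSpace ℝ (Fin p) ≃L[ℝ] EuclideanSpace ℝ (Fin p))) (x : α) :
    Set (EuclideanSpace ℝ (Fin p)) :=
  {w | Tendsto (fun n : ℕ => infDist (cocycleIter T A n x w) (latticeZ p)) atTop (nhds 0)}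

/-- The affine line through `u` with direction `v`. -/
def lineDir {p : ℕ} (v u : EuclideanSpace ℝ (Fin p)) : Set (EuclideanSpace ℝ (Fin p)) :=
  {w | ∃ t : ℝ, w = u + t • v}

/-- The cylinder `Δ^ℓ` for a finite word `ℓ`. -/
def cylinder {β : Type*} (T : β → β) (Δl : ℤ → Set β) (ℓ : List ℤ) : Set β :=
  {x | ∀ k : Fin ℓ.length, T^[(k : ℕ)] x ∈ Δl (ℓ.get k)}

open MeasureTheory Filter Metric
open scoped BigOperators ENNReal

/-- Shorthand for Euclidean space. -/
abbrev EE (p : ℕ) := EuclideanSpace ℝ (Fin p)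

/-- Distance from the line `u + ℝ v` to the origin. -/
noncomputable def dl {p : ℕ} (v u : EE p) : ℝ := ‖u - (inner ℝ v u / ‖v‖ ^ 2) • v‖

theorem dl_nonneg {p : ℕ} (v u : EE p) : 0 ≤ dl v u := norm_nonneg _

theorem dl_attain {p : ℕ} (v u : EE p) : ∃ t : ℝ, dl v u = ‖u + t • v‖ :=
  ⟨-(inner ℝ v u / ‖v‖ ^ 2), by simp [dl, sub_eq_add_neg]⟩

theorem dl_le {p : ℕ} (v u : EE p) (t : ℝ) : dl v u ≤ ‖u + t • v‖ := by
  by_cases hv : v = 0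
  · subst hv; simp [dl]
  have hv' : ‖v‖ ≠ 0 := norm_ne_zero_iff.mpr hv
  set s := inner ℝ v u / ‖v‖ ^ 2 with hs
  have horth : inner ℝ (u - s • v) ((t + s) • v) = 0 := by
    rw [inner_smul_right, inner_sub_left, inner_smul_left, real_inner_self_eq_norm_sq,
      real_inner_comm]
    simp only [conj_trivial]
    rw [hs]; field_simp; ring
  have h : u + t • v = (u - s • v) + (t + s) • v := by rw [add_smul]; abel
  have h2 := norm_add_sq_eq_norm_sq_add_norm_sq_of_inner_eq_zero _ _ horth
  rw [← h] at h2
  unfold dl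
  rw [← hs]
  nlinarith [norm_nonneg (u + t • v), norm_nonneg (u - s • v), norm_nonneg ((t + s) • v),
    mul_nonneg (norm_nonneg ((t + s) • v)) (norm_nonneg ((t + s) • v)), sq_nonneg (‖u + t • v‖ + ‖u - s • v‖)]

theorem dl_eq_iff_aux {p : ℕ} {v u v' u' : EE p}
    (h : ∀ t : ℝ, ∃ s : ℝ, u + t • v = u' + s • v') : dl v' u' ≤ dl v u := by
  obtain ⟨t, ht⟩ := dl_attain v u
  obtain ⟨s, hs⟩ := h t
  rw [ht, hs]; exact dl_le _ _ _

theorem dl_smul_left {p : ℕ} (v u : EE p) {c : ℝ} (hc : c ≠ 0) : dl (c • v) u = dl v u := by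
  apply le_antisymm
  · apply dl_eq_iff_aux; intro t; exact ⟨t / c, by rw [smul_smul]; field_simp⟩
  · apply dl_eq_iff_aux; intro t; exact ⟨t * c, by rw [smul_smul]⟩

theorem dl_add_smul {p : ℕ} (v u : EE p) (s : ℝ) : dl v (u + s • v) = dl v u := by
  apply le_antisymm
  · apply dl_eq_iff_aux; intro t; exact ⟨t - s, by rw [sub_smul]; abel⟩
  · apply dl_eq_iff_aux; intro t; exact ⟨t + s, by rw [add_smul]; abel⟩

theorem dl_smul_right {p : ℕ} (v u : EE p) (c : ℝ) : dl v (c • u) = |c| * dl v u := by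
  unfold dl
  rw [← Real.norm_eq_abs, ← norm_smul, smul_sub, smul_smul, inner_smul_right]
  congr 3; ring

theorem dl_continuousAt {p : ℕ} {v u : EE p} (hv : v ≠ 0) :
    ContinuousAt (fun q : EE p × EE p => dl q.1 q.2) (v, u) := by
  unfold dl
  have hv' : ‖v‖ ≠ 0 := norm_ne_zero_iff.mpr hv
  have : ContinuousAt (fun q : EE p × EE p => inner ℝ q.1 q.2 / ‖q.1‖ ^ 2) (v, u) := by
    apply ContinuousAt.div
    · fun_prop
    · fun_prop
    · simpa using hv
  fun_prop

theorem dl_measurable {α : Type*} [MeasurableSpace α] {p : ℕ} {f g : α → EE p} (hf : Measurable f)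
    (hg : Measurable g) : Measurable fun x => dl (f x) (g x) := by
  unfold dl
  have : Measurable (fun x => inner ℝ (f x) (g x)) := hf.inner hg
  have h2 : Measurable (fun x => inner ℝ (f x) (g x) / ‖f x‖ ^ 2) :=
    this.div (hf.norm.pow_const 2)
  exact (hg.sub (h2.smul hf)).norm

theorem dl_pos_iff {p : ℕ} {v u : EE p} : 0 < dl v u ↔ (0 : EE p) ∉ lineDir v u := by
  constructor
  · rintro h ⟨t, ht⟩
    have := dl_le v u t
    rw [← ht, norm_zero] at this; linarith
  · intro h
    obtain ⟨t, ht⟩ := dl_attain v u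
    rw [ht, norm_pos_iff]
    intro h0; exact h ⟨t, h0.symm⟩

/-- Under a linear equivalence with bounds. -/
theorem dl_map_lower {p : ℕ} (L : EE p ≃L[ℝ] EE p) {B : ℝ} (hB : ∀ w, ‖w‖ ≤ B * ‖L w‖) (v u : EE p) :
    dl v u ≤ B * dl (L v) (L u) := by
  obtain ⟨t, ht⟩ := dl_attain (L v) (L u)
  rw [ht]
  have : L u + t • L v = L (u + t • v) := by simp
  rw [this]
  exact (dl_le v u t).trans (hB _)

theorem dl_map_upper {p : ℕ} (L : EE p ≃L[ℝ] EE p) {B : ℝ} (hB : ∀ w, ‖L w‖ ≤ B * ‖w‖) (v u : EE p) :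
    dl (L v) (L u) ≤ B * dl v u := by
  obtain ⟨t, ht⟩ := dl_attain v u
  rw [ht]
  have : L (u + t • v) = L u + t • L v := by simp
  exact (dl_le _ _ t).trans (this ▸ hB _)

/-- Outer-measure zero-one law for strictly invariant sets. -/
theorem outer_zero_one {α : Type*} [MeasurableSpace α] {μ : Measure α} [IsProbabilityMeasure μ]
    {T : α → α} (hT : Ergodic T μ) {F : Set α} (hF : T ⁻¹' F = F) : μ F = 0 ∨ μ F = 1 := by
  set H := toMeasurable μ F with hH
  have hHm : MeasurableSet H := measurableSet_toMeasurable _ _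
  have hFH : F ⊆ H := subset_toMeasurable _ _
  have hHF : μ H = μ F := measure_toMeasurable _
  have hTm := hT.measurable
  have hF2 : F ⊆ H ∩ T ⁻¹' H := Set.subset_inter hFH (by
    conv_lhs => rw [← hF]
    exact Set.preimage_mono hFH)
  have h1 : μ (H \ T ⁻¹' H) = 0 := by
    have : μ (H ∩ T ⁻¹' H) + μ (H \ T ⁻¹' H) = μ H := measure_inter_add_sdiff H (hTm hHm)
    have h2 : μ H ≤ μ (H ∩ T ⁻¹' H) := hHF ▸ measure_mono hF2
    have h3 : μ (H ∩ T ⁻¹' H) ≠ ⊤ := measure_ne_top _ _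
    by_contra hne
    have : μ (H ∩ T ⁻¹' H) < μ H := by
      rw [← this]; exact ENNReal.lt_add_right h3 hne
    exact absurd h2 (not_le.mpr this)
  have h4 : H ≤ᵐ[μ] T ⁻¹' H := ae_le_set.mpr h1
  rcases hT.ae_empty_or_univ_of_ae_le_preimage hHm.nullMeasurableSet h4 with h | h
  · left; rw [← hHF, measure_congr h]; simp
  · right; rw [← hHF, measure_congr h]; simp

/-- Compactness lemma (Dini for decreasing families of sets). -/
theorem dini_sets {α Y : Type*} [MeasurableSpace α] {μ : Measure α} [IsProbabilityMeasure μ]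
    [TopologicalSpace Y] [FirstCountableTopology Y] {S : Set Y} (hS : IsCompact S) (bad : ℕ → Y → Set α)
    (hm : ∀ n, ∀ y ∈ S, MeasurableSet (bad n y))
    (hanti : ∀ y, Antitone fun n => bad n y)
    (hcl : ∀ n, ∀ y ∈ S, ∀ f : ℕ → Y, (∀ k, f k ∈ S) → Tendsto f atTop (nhds y) → ∀ x,
      (∃ᶠ k in atTop, x ∈ bad n (f k)) → x ∈ bad n y)
    (h0 : ∀ y ∈ S, μ (⋂ n, bad n y) = 0) {η : ℝ≥0∞} (hη : 0 < η) :
    ∃ n, ∀ y ∈ S, μ (bad n y) ≤ η := by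
  by_contra hcon
  push Not at hcon
  choose f hfS hf using hcon
  obtain ⟨y, hyS, φ, hφ, hlim⟩ := hS.isSeqCompact hfS
  have key : ∀ m, η ≤ μ (bad m y) := by
    intro m
    have h1 : limsup (fun k => μ (bad m (f (φ k)))) atTop ≤ μ (limsup (fun k => bad m (f (φ k))) atTop) := by
      rw [limsup_eq_iInf_iSup_of_nat]
      have hlimsup : limsup (fun k => bad m (f (φ k))) atTop = ⋂ n, ⋃ i ≥ n, bad m (f (φ i)) := by
        rw [limsup_eq_iInf_iSup_of_nat]; simp
      rw [hlimsup, Antitone.measure_iInter]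
      · apply iInf_mono; intro n
        apply iSup₂_le; intro i hi
        exact measure_mono (Set.subset_biUnion_of_mem (u := fun i => bad m (f (φ i))) hi)
      · intro a b hab
        exact Set.biUnion_subset_biUnion_left fun i hi => le_trans hab hi
      · intro n
        exact (MeasurableSet.biUnion (Set.to_countable _) fun i _ => hm m _ (hfS _)).nullMeasurableSet
      · exact ⟨0, measure_ne_top _ _⟩
    have h2 : limsup (fun k => bad m (f (φ k))) atTop ⊆ bad m y := by
      intro x hx
      rw [mem_limsup_iff_frequently_mem] at hx
      exact hcl m y hyS _ (fun k => hfS _) hlim x hx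
    refine le_trans ?_ (h1.trans (measure_mono h2))
    refine le_limsup_of_frequently_le ?_ (by isBoundedDefault)
    · apply Eventually.frequently
      filter_upwards [eventually_ge_atTop m] with k hk
      exact (hf (φ k)).le.trans (measure_mono (hanti _ (hk.trans (hφ.id_le k))))
  have : η ≤ μ (⋂ n, bad n y) := by
    rw [Antitone.measure_iInter (hanti y) (fun n => (hm n y hyS).nullMeasurableSet) ⟨0, measure_ne_top _ _⟩]
    exact le_iInf key
  rw [h0 y hyS] at this
  exact absurd hη (not_lt.mpr this)

open MeasureTheory Filter Metric
open scoped BigOperators ENNReal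

/-- All the structure used in the proof, in abstract form. -/
structure Sys {α : Type*} [MeasurableSpace α] {p : ℕ} (μ : Measure α) (T : α → α)
    (A : α → (EE p ≃L[ℝ] EE p)) (b : α → ℝ) (Θ : Set (EE p)) (K : ℝ≥0∞)
    (M : Measure α → Prop) (P : (k : ℕ) → (Fin k → ℤ) → Set α) : Prop where
  prob : IsProbabilityMeasure μ
  erg : Ergodic T μ
  Kne : K ≠ ⊤
  K0 : K ≠ 0
  Mμ : M μ
  Mprob : ∀ ν, M ν → IsProbabilityMeasure ν
  Mle : ∀ ν, M ν → ν ≤ K • μ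
  Pmeas : ∀ k f, MeasurableSet (P k f)
  Pdisj : ∀ k, Pairwise (Function.onFun Disjoint (P k))
  Pcover : ∀ k, μ (⋃ f, P k f)ᶜ = 0
  Mstep : ∀ ν, M ν → ∀ k f, ∃ ν', M ν' ∧ (ν.restrict (P k f)).map (T^[k]) = ν (P k f) • ν'
  PA : ∀ k f, ∀ x ∈ P k f, ∀ y ∈ P k f, ∀ j < k, A (T^[j] x) = A (T^[j] y)
  Pb : ∀ k f, ∀ x ∈ P k f, ∀ y ∈ P k f, ∀ j < k, b (T^[j] x) = b (T^[j] y)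
  Ameas : ∀ w, Measurable fun x => A x w
  bmeas : Measurable b
  bnn : ∀ x, 0 ≤ b x
  bint : Integrable b μ
  bub : ∀ x w, ‖A x w‖ ≤ Real.exp (b x) * ‖w‖
  blb : ∀ x w, ‖w‖ ≤ Real.exp (b x) * ‖A x w‖
  Θcomp : IsCompact Θ
  Θ0 : (0 : EE p) ∉ Θ
  Θinv : ∀ x, ∀ v ∈ Θ, ∃ t : ℝ, 0 < t ∧ t • (A x v) ∈ Θ
  Θexp : ∀ᵐ x ∂μ, ∀ v ∈ Θ, ∀ c : ℝ, c ≠ 0 →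
      ‖c • v‖ ≤ ‖A x (c • v)‖ ∧
        Tendsto (fun n : ℕ => ‖cocycleIter T A n x (c • v)‖) atTop atTop
  latInt : ∀ x, ∀ w ∈ latticeZ p, A x w ∈ latticeZ p ∧ (A x).symm w ∈ latticeZ p
  hcs : ∀ v ∈ Θ, ∀ u : EE p, (0 : EE p) ∉ lineDir v u →
      ∀ᵐ x ∂μ, lineDir v u ∩ centralStable T A x = ∅

/-- Nonzero multiples of elements of `Θ`. -/
def cone {p : ℕ} (Θ : Set (EE p)) : Set (EE p) := {w | ∃ c : ℝ, c ≠ 0 ∧ ∃ v ∈ Θ, w = c • v}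

/-- Sum of the logarithmic bounds along the orbit. -/
noncomputable def bs {α : Type*} (T : α → α) (b : α → ℝ) (n : ℕ) (x : α) : ℝ :=
  ∑ k ∈ Finset.range n, b (T^[k] x)

set_option linter.unusedSectionVars false

section
variable {α : Type*} [MeasurableSpace α] {p : ℕ} {μ : Measure α} {T : α → α}
    {A : α → (EE p ≃L[ℝ] EE p)} {b : α → ℝ} {Θ : Set (EE p)} {K : ℝ≥0∞}
    {M : Measure α → Prop} {P : (k : ℕ) → (Fin k → ℤ) → Set α}

theorem cocycle_add (T : α → α) (A : α → (EE p ≃L[ℝ] EE p)) (n k : ℕ) (x : α) (w : EE p) :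
    cocycleIter T A (n + k) x w = cocycleIter T A k (T^[n] x) (cocycleIter T A n x w) := by
  induction n generalizing x w with
  | zero => simp [cocycleIter]
  | succ n ih =>
    rw [show n + 1 + k = (n + k) + 1 by ring]
    simp only [cocycleIter, ContinuousLinearEquiv.trans_apply, Function.iterate_succ, Function.comp]
    exact ih _ _

theorem cocycle_succ' (T : α → α) (A : α → (EE p ≃L[ℝ] EE p)) (n : ℕ) (x : α) (w : EE p) :
    cocycleIter T A (n + 1) x w = A (T^[n] x) (cocycleIter T A n x w) := by
  rw [cocycle_add]; simp [cocycleIter]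

theorem cocycle_zero (T : α → α) (A : α → (EE p ≃L[ℝ] EE p)) (x : α) (w : EE p) :
    cocycleIter T A 0 x w = w := rfl

theorem cocycle_congr (T : α → α) (A : α → (EE p ≃L[ℝ] EE p)) (n : ℕ) (x y : α)
    (h : ∀ j < n, A (T^[j] x) = A (T^[j] y)) : cocycleIter T A n x = cocycleIter T A n y := by
  apply ContinuousLinearEquiv.ext; funext w
  induction n generalizing w with
  | zero => simp [cocycleIter]
  | succ n ih =>
    rw [cocycle_succ', cocycle_succ', ih (fun j hj => h j (by omega)), h n (by omega)]

theorem bs_succ (T : α → α) (b : α → ℝ) (n : ℕ) (x : α) : bs T b (n + 1) x = bs T b n x + b (T^[n] x) := by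
  simp [bs, Finset.sum_range_succ]

theorem bs_congr (T : α → α) (b : α → ℝ) (n : ℕ) (x y : α)
    (h : ∀ j < n, b (T^[j] x) = b (T^[j] y)) : bs T b n x = bs T b n y :=
  Finset.sum_congr rfl fun j hj => h j (Finset.mem_range.mp hj)

namespace Sys
variable (S : Sys μ T A b Θ K M P)

theorem Tm (S : Sys μ T A b Θ K M P) : Measurable T := S.erg.measurable

theorem mp (S : Sys μ T A b Θ K M P) : MeasurePreserving T μ μ := S.erg.toMeasurePreserving

theorem ac (S : Sys μ T A b Θ K M P) {ν : Measure α} (h : M ν) : ν ≪ μ :=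
  (Measure.absolutelyContinuous_of_le (S.Mle ν h)).trans (Measure.smul_absolutelyContinuous)

theorem lint_le (S : Sys μ T A b Θ K M P) {ν : Measure α} (h : M ν) (f : α → ℝ≥0∞) :
    ∫⁻ x, f x ∂ν ≤ K * ∫⁻ x, f x ∂μ := by
  calc ∫⁻ x, f x ∂ν ≤ ∫⁻ x, f x ∂(K • μ) := lintegral_mono' (S.Mle ν h) le_rfl
    _ = _ := by rw [lintegral_smul_measure]; rfl

theorem meas_le (S : Sys μ T A b Θ K M P) {ν : Measure α} (h : M ν) (s : Set α) :
    ν s ≤ K * μ s := by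
  have := S.Mle ν h s
  simpa using this

theorem ae_iter (S : Sys μ T A b Θ K M P) {q : α → Prop} (h : ∀ᵐ x ∂μ, q x) :
    ∀ᵐ x ∂μ, ∀ n : ℕ, q (T^[n] x) := by
  rw [ae_all_iff]; intro n
  exact (S.mp.iterate n).quasiMeasurePreserving.ae h

theorem joint_meas (S : Sys μ T A b Θ K M P) (n : ℕ) :
    Measurable fun q : EE p × α => cocycleIter T A n q.2 q.1 := by
  induction n with
  | zero => exact measurable_fst
  | succ n ih =>
    have h1 : Measurable (Function.uncurry fun (w : EE p) (x : α) => A x w) :=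
      measurable_uncurry_of_continuous_of_measurable (fun x => (A x).continuous) S.Ameas
    have h2 : (fun q : EE p × α => cocycleIter T A (n+1) q.2 q.1)
        = fun q => (Function.uncurry fun (w : EE p) (x : α) => A x w)
            (cocycleIter T A n q.2 q.1, T^[n] q.2) := by
      funext q; rw [cocycle_succ']; rfl
    rw [h2]
    exact h1.comp (ih.prodMk ((S.Tm.iterate n).comp measurable_snd))

theorem coc_meas (S : Sys μ T A b Θ K M P) (n : ℕ) (w : EE p) :
    Measurable fun x => cocycleIter T A n x w := by
  have h1 : Measurable fun x : α => ((w, x) : EE p × α) := measurable_prodMk_left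
  exact (S.joint_meas n).comp h1

theorem dl_meas (S : Sys μ T A b Θ K M P) (n : ℕ) (v u : EE p) :
    Measurable fun x => dl (cocycleIter T A n x v) (cocycleIter T A n x u) := 
  dl_measurable (S.coc_meas n v) (S.coc_meas n u)

theorem cone_ne (S : Sys μ T A b Θ K M P) {v : EE p} (hv : v ∈ cone Θ) : v ≠ 0 := by
  obtain ⟨c, hc, w, hw, rfl⟩ := hv
  exact smul_ne_zero hc (fun h => S.Θ0 (h ▸ hw))

theorem cone_A (S : Sys μ T A b Θ K M P) (x : α) {v : EE p} (hv : v ∈ cone Θ) : A x v ∈ cone Θ := by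
  obtain ⟨c, hc, w, hw, rfl⟩ := hv
  obtain ⟨t, ht, h⟩ := S.Θinv x w hw
  refine ⟨c / t, div_ne_zero hc ht.ne', _, h, ?_⟩
  rw [smul_smul, map_smul]; congr 1; field_simp

theorem cone_coc (S : Sys μ T A b Θ K M P) (n : ℕ) (x : α) {v : EE p} (hv : v ∈ cone Θ) :
    cocycleIter T A n x v ∈ cone Θ := by
  induction n with
  | zero => exact hv
  | succ n ih => rw [cocycle_succ']; exact S.cone_A _ ih

theorem cone_smul {v : EE p} (hv : v ∈ cone Θ) {c : ℝ} (hc : c ≠ 0) : c • v ∈ cone Θ := by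
  obtain ⟨d, hd, w, hw, rfl⟩ := hv
  exact ⟨c * d, mul_ne_zero hc hd, w, hw, smul_smul _ _ _⟩

/-- Almost every orbit is monotone and unbounded on the cone. -/
theorem ae_mono (S : Sys μ T A b Θ K M P) :
    ∀ᵐ x ∂μ, ∀ m : ℕ, ∀ v ∈ cone Θ, (Monotone fun n => ‖cocycleIter T A n (T^[m] x) v‖) ∧
      Tendsto (fun n : ℕ => ‖cocycleIter T A n (T^[m] x) v‖) atTop atTop := by
  filter_upwards [S.ae_iter S.Θexp] with x hx m v hv
  constructor
  · apply monotone_nat_of_le_succ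
    intro n
    rw [cocycle_succ']
    obtain ⟨c, hc, w, hw, h⟩ := S.cone_coc n (T^[m] x) hv
    have := (hx (n + m) w hw c hc).1
    rwa [h, ← Function.iterate_add_apply]
  · obtain ⟨c, hc, w, hw, rfl⟩ := hv
    exact (hx m w hw c hc).2

theorem ub (S : Sys μ T A b Θ K M P) (n : ℕ) (x : α) (w : EE p) :
    ‖cocycleIter T A n x w‖ ≤ Real.exp (bs T b n x) * ‖w‖ := by
  induction n with
  | zero => simp [bs, cocycle_zero]
  | succ n ih =>
    rw [cocycle_succ', bs_succ, Real.exp_add, mul_comm (Real.exp _), mul_assoc]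
    exact (S.bub _ _).trans (by gcongr)

theorem lb (S : Sys μ T A b Θ K M P) (n : ℕ) (x : α) (w : EE p) :
    ‖w‖ ≤ Real.exp (bs T b n x) * ‖cocycleIter T A n x w‖ := by
  induction n with
  | zero => simp [bs, cocycle_zero]
  | succ n ih =>
    rw [cocycle_succ', bs_succ, Real.exp_add, mul_assoc]
    exact ih.trans (by gcongr; exact S.blb _ _)

theorem bs_nn (S : Sys μ T A b Θ K M P) (n : ℕ) (x : α) : 0 ≤ bs T b n x :=
  Finset.sum_nonneg fun _ _ => S.bnn _

theorem bk_int (S : Sys μ T A b Θ K M P) (k : ℕ) : Integrable (fun x => b (T^[k] x)) μ :=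
  (S.mp.iterate k).integrable_comp_of_integrable S.bint

theorem bs_int (S : Sys μ T A b Θ K M P) (n : ℕ) : Integrable (bs T b n) μ :=
  integrable_finsetSum _ fun k _ => S.bk_int k

theorem int_M (S : Sys μ T A b Θ K M P) {ν : Measure α} (h : M ν) {f : α → ℝ} (hf : Integrable f μ) :
    Integrable f ν :=
  (hf.smul_measure S.Kne).mono_measure (S.Mle ν h)

theorem lint_iter (S : Sys μ T A b Θ K M P) (k : ℕ) {f : α → ℝ≥0∞} (hf : AEMeasurable f μ) :
    ∫⁻ x, f (T^[k] x) ∂μ = ∫⁻ x, f x ∂μ := by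
  have := (S.mp.iterate k).map_eq
  conv_rhs => rw [← this]
  rw [lintegral_map' (by rw [this]; exact hf) (S.Tm.iterate k).aemeasurable]

theorem Pcover_M (S : Sys μ T A b Θ K M P) {ν : Measure α} (h : M ν) (k : ℕ) :
    ∀ᵐ x ∂ν, x ∈ ⋃ f, P k f :=
  S.ac h (S.Pcover k)

theorem lint_split (S : Sys μ T A b Θ K M P) {ν : Measure α} (h : M ν) (k : ℕ) (f : α → ℝ≥0∞) :
    ∫⁻ x, f x ∂ν = ∑' i, ∫⁻ x in P k i, f x ∂ν := by
  rw [← lintegral_iUnion (S.Pmeas k) (S.Pdisj k)]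
  rw [Measure.restrict_eq_self_of_ae_mem (S.Pcover_M h k)]

/-- Conditioning, function version. -/
theorem dec (S : Sys μ T A b Θ K M P) {ν : Measure α} (h : M ν) (k : ℕ) (H : α → α → ℝ≥0∞)
    (G : α → ℝ≥0∞) (hm : ∀ x, Measurable (H x))
    (hc : ∀ f, ∀ x ∈ P k f, ∀ y ∈ P k f, H x = H y)
    (hb : ∀ x, ∀ ν', M ν' → ∫⁻ y, H x y ∂ν' ≤ G x) :
    ∫⁻ x, H x (T^[k] x) ∂ν ≤ ∫⁻ x, G x ∂ν := by
  rw [S.lint_split h k, S.lint_split h k G]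
  refine ENNReal.tsum_le_tsum fun f => ?_
  rcases (P k f).eq_empty_or_nonempty with he | ⟨x₀, hx₀⟩
  · simp [he]
  obtain ⟨ν', hν', hmap⟩ := S.Mstep ν h k f
  calc ∫⁻ x in P k f, H x (T^[k] x) ∂ν = ∫⁻ x in P k f, H x₀ (T^[k] x) ∂ν :=
        setLIntegral_congr_fun (S.Pmeas k f) fun x hx => by rw [hc f x hx x₀ hx₀]
    _ = ∫⁻ y, H x₀ y ∂((ν.restrict (P k f)).map (T^[k])) :=
        (lintegral_map (hm x₀) (S.Tm.iterate k)).symm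
    _ = ν (P k f) * ∫⁻ y, H x₀ y ∂ν' := by rw [hmap, lintegral_smul_measure]; rfl
    _ = ∫⁻ x in P k f, (∫⁻ y, H x₀ y ∂ν') ∂ν := by rw [setLIntegral_const, mul_comm]
    _ ≤ ∫⁻ x in P k f, G x ∂ν := setLIntegral_mono' (S.Pmeas k f) fun x hx => by
        rw [hc f x₀ hx₀ x hx]; exact hb x ν' hν'

/-- Conditioning, set version. -/
theorem dec_set (S : Sys μ T A b Θ K M P) {ν : Measure α} (h : M ν) (k : ℕ) (X : α → Set α)
    (G : α → ℝ≥0∞)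
    (hc : ∀ f, ∀ x ∈ P k f, ∀ y ∈ P k f, X x = X y)
    (hb : ∀ᵐ x ∂ν, ∀ ν', M ν' → ν' (X x) ≤ G x) :
    ν {x | T^[k] x ∈ X x} ≤ ∫⁻ x, G x ∂ν := by
  rw [S.lint_split h k G]
  have h1 : ν {x | T^[k] x ∈ X x} ≤ ν (⋃ f, {x | T^[k] x ∈ X x} ∩ P k f) := by
    apply measure_mono_ae
    filter_upwards [S.Pcover_M h k] with x hx hx'
    rw [Set.mem_iUnion] at hx
    obtain ⟨f, hf⟩ := hx
    exact Set.mem_iUnion.mpr ⟨f, hx', hf⟩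
  refine h1.trans ((measure_iUnion_le _).trans (ENNReal.tsum_le_tsum fun f => ?_))
  rcases (P k f).eq_empty_or_nonempty with he | ⟨x₀, hx₀⟩
  · simp [he]
  obtain ⟨ν', hν', hmap⟩ := S.Mstep ν h k f
  calc ν ({x | T^[k] x ∈ X x} ∩ P k f) ≤ ν (T^[k] ⁻¹' (X x₀) ∩ P k f) :=
        measure_mono fun x hx => ⟨by rw [Set.mem_preimage, ← hc f x hx.2 x₀ hx₀]; exact hx.1, hx.2⟩
    _ = ν.restrict (P k f) (T^[k] ⁻¹' (X x₀)) := (Measure.restrict_apply' (S.Pmeas k f)).symm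
    _ ≤ ((ν.restrict (P k f)).map (T^[k])) (X x₀) :=
        Measure.le_map_apply (S.Tm.iterate k).aemeasurable _
    _ = ν (P k f) * ν' (X x₀) := by rw [hmap]; rfl
    _ = ∫⁻ x in P k f, ν' (X x₀) ∂ν := by rw [setLIntegral_const, mul_comm]
    _ ≤ ∫⁻ x in P k f, G x ∂ν := by
        apply setLIntegral_mono_ae' (S.Pmeas k f)
        filter_upwards [hb] with x hx hxP
        rw [hc f x₀ hx₀ x hxP]; exact hx ν' hν'

end Sys
end

open MeasureTheory Filter Metric
open scoped BigOperators ENNReal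
set_option linter.unusedSectionVars false

section
variable {α : Type*} [MeasurableSpace α] {p : ℕ} {μ : Measure α} {T : α → α}
    {A : α → (EE p ≃L[ℝ] EE p)} {b : α → ℝ} {Θ : Set (EE p)} {K : ℝ≥0∞}
    {M : Measure α → Prop} {P : (k : ℕ) → (Fin k → ℤ) → Set α}
namespace Sys

theorem closed_aux {u w : ℕ → ℝ} {a c : ℝ} (hu : Tendsto u atTop (nhds a)) (hw : Tendsto w atTop (nhds c))
    (h : ∃ᶠ k in atTop, u k ≤ w k) : a ≤ c := by
  have h1 : Tendsto (fun k => u k - w k) atTop (nhds (a - c)) := hu.sub hw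
  have := le_of_tendsto_of_frequently h1 (h.mono fun k hk => (sub_nonpos.mpr hk))
  linarith

theorem v_unif (S : Sys μ T A b Θ K M P) : ∃ n0 : ℕ, 1 ≤ n0 ∧ ∀ v ∈ cone Θ, ∀ ν, M ν →
    ν {x | ∀ k ≤ n0, ‖cocycleIter T A k x v‖ ≤ 2 * ‖v‖} ≤ 1 / 2 := by
  haveI := S.prob
  set bad : ℕ → EE p → Set α := fun n v => {x | ∀ k ≤ n, ‖cocycleIter T A k x v‖ ≤ 2 * ‖v‖} with hbad
  have hanti : ∀ v, Antitone fun n => bad n v := fun v m n hmn x hx k hk => hx k (hk.trans hmn)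
  have hη : (0 : ℝ≥0∞) < (2 * K)⁻¹ := by
    rw [ENNReal.inv_pos]; exact ENNReal.mul_ne_top (by simp) S.Kne
  have hdini : ∃ n, ∀ v ∈ Θ, μ (bad n v) ≤ (2 * K)⁻¹ := by
    refine dini_sets (μ := μ) S.Θcomp bad ?_ hanti ?_ ?_ hη
    · intro n v _
      have : bad n v = ⋂ k, ⋂ (_ : k ≤ n), {x | ‖cocycleIter T A k x v‖ ≤ 2 * ‖v‖} := by
        ext x; simp [hbad]
      rw [this]
      exact MeasurableSet.iInter fun k => MeasurableSet.iInter fun _ =>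
        measurableSet_le (S.coc_meas k v).norm measurable_const
    · intro n v hv f hf hlim x hx k hk
      have h1 : Tendsto (fun j => ‖cocycleIter T A k x (f j)‖) atTop (nhds ‖cocycleIter T A k x v‖) :=
        (((cocycleIter T A k x).continuous.norm).tendsto v).comp hlim
      exact closed_aux h1 (hlim.norm.const_mul 2) (hx.mono fun j hj => hj k hk)
    · intro v hv
      have hvc : v ∈ cone Θ := ⟨1, one_ne_zero, v, hv, by simp⟩
      have : ∀ᵐ x ∂μ, x ∉ ⋂ n, bad n v := by
        filter_upwards [S.ae_mono] with x hx hmem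
        have h1 := (hx 0 v hvc).2
        obtain ⟨k, hk⟩ := (h1.eventually_gt_atTop (2 * ‖v‖)).exists
        have := Set.mem_iInter.mp hmem k k le_rfl
        simp at hk this
        linarith
      exact measure_eq_zero_iff_ae_notMem.mpr this
  obtain ⟨n, hn⟩ := hdini
  · refine ⟨n + 1, by omega, ?_⟩
    rintro v ⟨c, hc, w, hw, rfl⟩ ν hν
    have h1 : {x | ∀ k ≤ n + 1, ‖cocycleIter T A k x (c • w)‖ ≤ 2 * ‖c • w‖} ⊆ bad n w := by
      intro x hx k hk
      have := hx k (by omega)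
      rw [map_smul, norm_smul, norm_smul] at this
      have hc' : 0 < ‖c‖ := norm_pos_iff.mpr hc
      by_contra hcon
      push Not at hcon
      nlinarith
    calc _ ≤ ν (bad n w) := measure_mono h1
      _ ≤ K * μ (bad n w) := S.meas_le hν _
      _ ≤ K * (2 * K)⁻¹ := by gcongr; exact hn w hw
      _ = 1 / 2 := by
        rw [ENNReal.mul_inv (by simp) (by simp), mul_comm, mul_assoc,
          ENNReal.inv_mul_cancel S.K0 S.Kne]; simp

theorem v_step (S : Sys μ T A b Θ K M P) : ∃ n0 : ℕ, 1 ≤ n0 ∧ ∀ v ∈ cone Θ, ∀ ν, M ν →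
    ∫⁻ x, ENNReal.ofReal (‖v‖ / ‖cocycleIter T A n0 x v‖) ∂ν ≤ ENNReal.ofReal (3 / 4) := by
  obtain ⟨n0, h1, h⟩ := S.v_unif
  refine ⟨n0, h1, fun v hv ν hν => ?_⟩
  haveI := S.Mprob ν hν
  set bd := {x | ∀ k ≤ n0, ‖cocycleIter T A k x v‖ ≤ 2 * ‖v‖} with hbd
  have hm : MeasurableSet bd := by
    have : bd = ⋂ k, ⋂ (_ : k ≤ n0), {x | ‖cocycleIter T A k x v‖ ≤ 2 * ‖v‖} := by
      ext x; simp [hbd]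
    rw [this]
    exact MeasurableSet.iInter fun k => MeasurableSet.iInter fun _ =>
      measurableSet_le (S.coc_meas k v).norm measurable_const
  have hv0 : 0 < ‖v‖ := norm_pos_iff.mpr (S.cone_ne hv)
  have hle : ∀ᵐ x ∂ν, ENNReal.ofReal (‖v‖ / ‖cocycleIter T A n0 x v‖) ≤
      1 / 2 + bd.indicator (fun _ => 1 / 2) x := by
    filter_upwards [S.ac hν S.ae_mono] with x hx
    have hmono := (hx 0 v hv).1
    simp only [Function.iterate_zero, id] at hmono
    have hpos : 0 < ‖cocycleIter T A n0 x v‖ := norm_pos_iff.mpr (S.cone_ne (S.cone_coc n0 x hv))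
    by_cases hxb : x ∈ bd
    · rw [Set.indicator_of_mem hxb, ENNReal.add_halves]
      rw [← ENNReal.ofReal_one]
      apply ENNReal.ofReal_le_ofReal
      rw [div_le_one hpos]
      simpa [cocycle_zero] using hmono (Nat.zero_le n0)
    · rw [Set.indicator_of_notMem hxb, add_zero]
      have hxb' : ∃ k ≤ n0, 2 * ‖v‖ < ‖cocycleIter T A k x v‖ := by
        simpa [hbd] using hxb
      obtain ⟨k, hk, hk2⟩ := hxb'
      have := hmono hk
      have e : (1 / 2 : ℝ≥0∞) = ENNReal.ofReal (1 / 2) := by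
        rw [ENNReal.ofReal_div_of_pos (by norm_num)]; simp
      rw [e]
      apply ENNReal.ofReal_le_ofReal
      rw [div_le_div_iff₀ hpos (by norm_num)]
      simp only at this
      linarith
  calc _ ≤ ∫⁻ x, (1 / 2 + bd.indicator (fun _ => 1 / 2) x) ∂ν := lintegral_mono_ae hle
    _ = 1 / 2 + 1 / 2 * ν bd := by
      rw [lintegral_add_left measurable_const, lintegral_const, lintegral_indicator hm,
        setLIntegral_const]; simp
    _ ≤ 1 / 2 + 1 / 2 * (1 / 2) := by gcongr; exact h v hv ν hν
    _ = ENNReal.ofReal (3 / 4) := by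
      have e : (1 / 2 : ℝ≥0∞) = ENNReal.ofReal (1 / 2) := by
        rw [ENNReal.ofReal_div_of_pos (by norm_num)]; simp
      rw [e, ← ENNReal.ofReal_mul (by norm_num), ← ENNReal.ofReal_add (by norm_num) (by norm_num)]
      norm_num

theorem v_exp (S : Sys μ T A b Θ K M P) : ∃ c > 0, ∃ C > 0, ∀ j : ℕ, ∀ v ∈ cone Θ, ∀ ν, M ν →
    ∫⁻ x, ENNReal.ofReal (‖v‖ / ‖cocycleIter T A j x v‖) ∂ν ≤ ENNReal.ofReal (C * Real.exp (-c * j)) := by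
  obtain ⟨n0, h1, h⟩ := S.v_step
  have hn0 : (0 : ℝ) < n0 := by exact_mod_cast h1
  refine ⟨Real.log (4 / 3) / n0, by have := Real.log_pos (show (1:ℝ) < 4/3 by norm_num); positivity,
    4 / 3, by norm_num, ?_⟩
  set c := Real.log (4 / 3) / n0 with hc
  have hcpos : 0 < c := by have := Real.log_pos (show (1:ℝ) < 4/3 by norm_num); positivity
  have hexp : Real.exp (-c * n0) = 3 / 4 := by
    rw [hc]; rw [show -(Real.log (4/3) / n0) * n0 = - Real.log (4/3) by field_simp]
    rw [Real.exp_neg, Real.exp_log (by norm_num)]; norm_num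
  intro j
  induction j using Nat.strong_induction_on with
  | _ j ih =>
  intro v hv ν hν
  haveI := S.Mprob ν hν
  have hv0 : 0 < ‖v‖ := norm_pos_iff.mpr (S.cone_ne hv)
  by_cases hj : j < n0
  · have : (1:ℝ) ≤ 4 / 3 * Real.exp (-c * j) := by
      have : Real.exp (-c * n0) ≤ Real.exp (-c * j) := by
        apply Real.exp_le_exp.mpr
        have : (j:ℝ) ≤ n0 := by exact_mod_cast hj.le
        nlinarith
      rw [hexp] at this; linarith
    calc _ ≤ ∫⁻ x, 1 ∂ν := by
          apply lintegral_mono_ae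
          filter_upwards [S.ac hν S.ae_mono] with x hx
          have hmono := (hx 0 v hv).1
          simp only [Function.iterate_zero, id] at hmono
          have hpos : 0 < ‖cocycleIter T A j x v‖ := norm_pos_iff.mpr (S.cone_ne (S.cone_coc j x hv))
          rw [← ENNReal.ofReal_one]
          apply ENNReal.ofReal_le_ofReal
          rw [div_le_one hpos]
          simpa [cocycle_zero] using hmono (Nat.zero_le j)
      _ = ENNReal.ofReal 1 := by simp
      _ ≤ _ := ENNReal.ofReal_le_ofReal this
  · push Not at hj
    obtain ⟨i, rfl⟩ := Nat.exists_eq_add_of_le hj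
    have key := S.dec hν n0
      (fun x y => ENNReal.ofReal (‖v‖ / ‖cocycleIter T A n0 x v‖) *
        ENNReal.ofReal (‖cocycleIter T A n0 x v‖ / ‖cocycleIter T A i y (cocycleIter T A n0 x v)‖))
      (fun x => ENNReal.ofReal (‖v‖ / ‖cocycleIter T A n0 x v‖) *
        ENNReal.ofReal (4 / 3 * Real.exp (-c * i))) ?_ ?_ ?_
    · calc _ = ∫⁻ x, ENNReal.ofReal (‖v‖ / ‖cocycleIter T A n0 x v‖) *
          ENNReal.ofReal (‖cocycleIter T A n0 x v‖ /
            ‖cocycleIter T A i (T^[n0] x) (cocycleIter T A n0 x v)‖) ∂ν := by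
            apply lintegral_congr; intro x
            have hpos : 0 < ‖cocycleIter T A n0 x v‖ := norm_pos_iff.mpr (S.cone_ne (S.cone_coc n0 x hv))
            rw [← ENNReal.ofReal_mul (by positivity), ← cocycle_add]
            congr 1; field_simp
        _ ≤ _ := key
        _ ≤ ENNReal.ofReal (3 / 4) * ENNReal.ofReal (4 / 3 * Real.exp (-c * i)) := by
            rw [lintegral_mul_const' _ _ ENNReal.ofReal_ne_top]
            gcongr; exact h v hv ν hν
        _ = _ := by
            rw [← ENNReal.ofReal_mul (by norm_num), ← hexp]
            congr 1; push_cast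
            rw [mul_left_comm, ← Real.exp_add]; ring_nf
    · intro x
      exact ((measurable_const.div (S.coc_meas i _).norm).ennreal_ofReal).const_mul _
    · intro f x hx y hy
      rw [cocycle_congr T A n0 x y (S.PA n0 f x hx y hy)]
    · intro x ν' hν'
      rw [lintegral_const_mul' _ _ ENNReal.ofReal_ne_top]
      gcongr
      exact ih i (by omega) _ (S.cone_coc n0 x hv) ν' hν'

theorem v_exp2 (S : Sys μ T A b Θ K M P) : ∃ c > 0, ∃ C > 0, ∀ n j : ℕ, ∀ v ∈ cone Θ,
    ∫⁻ x, ENNReal.ofReal (‖cocycleIter T A n x v‖ / ‖cocycleIter T A (n + j) x v‖) ∂μ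
      ≤ ENNReal.ofReal (C * Real.exp (-c * j)) := by
  obtain ⟨c, hc, C, hC, h⟩ := S.v_exp
  refine ⟨c, hc, C, hC, fun n j v hv => ?_⟩
  haveI := S.prob
  have key := S.dec S.Mμ n
      (fun x y => ENNReal.ofReal (‖cocycleIter T A n x v‖ / ‖cocycleIter T A j y (cocycleIter T A n x v)‖))
      (fun x => ENNReal.ofReal (C * Real.exp (-c * j))) ?_ ?_ ?_
  · simpa [← cocycle_add] using key
  · intro x
    exact ((measurable_const.div (S.coc_meas j _).norm).ennreal_ofReal)
  · intro f x hx y hy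
    rw [cocycle_congr T A n x y (S.PA n f x hx y hy)]
  · intro x ν' hν'
    exact h j _ (S.cone_coc n x hv) ν' hν'

theorem v_ae (S : Sys μ T A b Θ K M P) : ∃ c > 0, ∀ ε > 0, ∀ v ∈ cone Θ,
    ∀ᵐ x ∂μ, ∃ C : ℝ, 0 ≤ C ∧ ∀ n j : ℕ, ‖cocycleIter T A n x v‖ ≤
      C * Real.exp (ε * n) * Real.exp (-c * j) * ‖cocycleIter T A (n + j) x v‖ := by
  obtain ⟨c, hc, C, hC, h⟩ := S.v_exp2
  refine ⟨c / 2, by positivity, fun ε hε v hv => ?_⟩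
  set F : ℕ × ℕ → α → ℝ≥0∞ := fun q x =>
    ENNReal.ofReal (Real.exp (-ε * q.1) * Real.exp (c / 2 * q.2)) *
      ENNReal.ofReal (‖cocycleIter T A q.1 x v‖ / ‖cocycleIter T A (q.1 + q.2) x v‖) with hF
  have hFm : ∀ q, Measurable (F q) := fun q =>
    (((S.coc_meas _ v).norm.div (S.coc_meas _ v).norm).ennreal_ofReal).const_mul _
  have hsum : Summable fun q : ℕ × ℕ => Real.exp (-ε * q.1) * (C * Real.exp (-(c / 2) * q.2)) := by
    have hg : ∀ a : ℝ, 0 < a → Summable fun n : ℕ => Real.exp (-a * n) := by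
      intro a ha
      have := summable_geometric_of_lt_one (Real.exp_nonneg (-a)) (by simpa using ha)
      refine this.congr fun n => ?_
      rw [← Real.exp_nat_mul]; ring_nf
    exact (hg ε hε).mul_of_nonneg ((hg (c / 2) (by positivity)).mul_left C)
      (fun n => (Real.exp_nonneg _)) (fun n => by positivity)
  have hfin : ∫⁻ x, ∑' q, F q x ∂μ ≠ ⊤ := by
    rw [lintegral_tsum fun q => (hFm q).aemeasurable]
    have : ∀ q, ∫⁻ x, F q x ∂μ ≤ ENNReal.ofReal (Real.exp (-ε * q.1) * (C * Real.exp (-(c / 2) * q.2))) := by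
      intro q
      simp only [hF]
      rw [lintegral_const_mul' _ _ ENNReal.ofReal_ne_top]
      calc _ ≤ ENNReal.ofReal (Real.exp (-ε * q.1) * Real.exp (c / 2 * q.2)) *
            ENNReal.ofReal (C * Real.exp (-c * q.2)) := by gcongr; exact h q.1 q.2 v hv
        _ = _ := by
          rw [← ENNReal.ofReal_mul (by positivity)]
          congr 1
          rw [show -(c / 2) * (q.2 : ℝ) = c / 2 * q.2 + -c * q.2 by ring, Real.exp_add]; ring
    refine ne_top_of_le_ne_top ?_ (ENNReal.tsum_le_tsum this)
    rw [← ENNReal.ofReal_tsum_of_nonneg (fun q => by positivity) hsum]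
    exact ENNReal.ofReal_ne_top
  filter_upwards [ae_lt_top (Measurable.ennreal_tsum hFm) hfin] with x hx
  refine ⟨(∑' q, F q x).toReal, ENNReal.toReal_nonneg, fun n j => ?_⟩
  have h1 : F (n, j) x ≤ ∑' q, F q x := ENNReal.le_tsum _
  have h2 := ENNReal.toReal_mono hx.ne h1
  simp only [hF] at h2
  have hpos : 0 < ‖cocycleIter T A (n + j) x v‖ := norm_pos_iff.mpr (S.cone_ne (S.cone_coc _ x hv))
  rw [← ENNReal.ofReal_mul (by positivity), ENNReal.toReal_ofReal (by positivity)] at h2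
  set D := (∑' q, F q x).toReal
  have e1 : Real.exp (ε * n) * Real.exp (-ε * n) = 1 := by rw [← Real.exp_add]; simp
  have e2 : Real.exp (-(c / 2) * j) * Real.exp (c / 2 * j) = 1 := by rw [← Real.exp_add]; simp
  have h3 : Real.exp (-ε * n) * Real.exp (c / 2 * j) * ‖cocycleIter T A n x v‖ ≤
      D * ‖cocycleIter T A (n + j) x v‖ := by
    rw [← mul_div_assoc, div_le_iff₀ hpos] at h2
    exact h2
  calc ‖cocycleIter T A n x v‖ = (Real.exp (ε * n) * Real.exp (-ε * n)) *
        (Real.exp (-(c / 2) * j) * Real.exp (c / 2 * j)) * ‖cocycleIter T A n x v‖ := by rw [e1, e2]; ring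
    _ = (Real.exp (ε * n) * Real.exp (-(c / 2) * j)) *
        (Real.exp (-ε * n) * Real.exp (c / 2 * j) * ‖cocycleIter T A n x v‖) := by ring
    _ ≤ (Real.exp (ε * n) * Real.exp (-(c / 2) * j)) * (D * ‖cocycleIter T A (n + j) x v‖) := by gcongr
    _ = _ := by ring

theorem b_ae (S : Sys μ T A b Θ K M P) {ε : ℝ} (hε : 0 < ε) :
    ∀ᵐ x ∂μ, ∃ C : ℝ, 0 ≤ C ∧ ∀ n : ℕ, b (T^[n] x) ≤ ε * n + C := by
  haveI := S.prob
  have hs : ∑' n : ℕ, μ {x | b x / ε ∈ Set.Ioi (n : ℝ)} < ⊤ := by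
    letI : MeasureSpace α := ⟨μ⟩
    haveI : IsProbabilityMeasure (volume : Measure α) := S.prob
    exact ProbabilityTheory.tsum_prob_mem_Ioi_lt_top (X := fun x => b x / ε) (S.bint.div_const ε)
      (fun x => div_nonneg (S.bnn x) hε.le)
  have hs2 : ∀ n : ℕ, μ (T^[n] ⁻¹' {x | b x / ε ∈ Set.Ioi (n : ℝ)}) = μ {x | b x / ε ∈ Set.Ioi (n : ℝ)} := by
    intro n
    apply (S.mp.iterate n).measure_preimage
    exact (S.bint.div_const ε).aemeasurable.nullMeasurable measurableSet_Ioi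
  have := measure_setOfPred_frequently_eq_zero (μ := μ) (p := fun (n : ℕ) x => T^[n] x ∈ {x | b x / ε ∈ Set.Ioi (n : ℝ)})
    (by
      have : ∀ n : ℕ, μ {x | T^[n] x ∈ {x | b x / ε ∈ Set.Ioi (n : ℝ)}} = _ := hs2
      simp only [this]; exact hs.ne)
  have h2 : ∀ᵐ x ∂μ, ¬ ∃ᶠ n : ℕ in atTop, T^[n] x ∈ {x | b x / ε ∈ Set.Ioi (n : ℝ)} := by
    rw [ae_iff]; simpa only [not_not] using this
  filter_upwards [h2] with x hx
  rw [not_frequently, eventually_atTop] at hx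
  obtain ⟨N, hN⟩ := hx
  refine ⟨bs T b N x, S.bs_nn N x, fun n => ?_⟩
  by_cases hn : N ≤ n
  · have := hN n hn
    simp only [Set.mem_ofPred_eq, Set.mem_Ioi, not_lt] at this
    rw [div_le_iff₀ hε] at this
    have := S.bs_nn N x
    linarith
  · have : b (T^[n] x) ≤ bs T b N x :=
      Finset.single_le_sum (f := fun k => b (T^[k] x)) (fun _ _ => S.bnn _) (Finset.mem_range.mpr (by omega))
    have : 0 ≤ ε * n := by positivity
    linarith

end Sys
end

open MeasureTheory Filter Metric
open scoped BigOperators ENNReal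
set_option linter.unusedSectionVars false

section
variable {α : Type*} [MeasurableSpace α] {p : ℕ} {μ : Measure α} {T : α → α}
    {A : α → (EE p ≃L[ℝ] EE p)} {b : α → ℝ} {Θ : Set (EE p)} {K : ℝ≥0∞}
    {M : Measure α → Prop} {P : (k : ℕ) → (Fin k → ℤ) → Set α}

/-- Vectors of growth rate at most `1/(i+1)`. -/
noncomputable def Vsub (T : α → α) (A : α → (EE p ≃L[ℝ] EE p)) (i : ℕ) (x : α) : Submodule ℝ (EE p) where
  carrier := {w | ∃ C : ℝ, ∀ n : ℕ, ‖cocycleIter T A n x w‖ ≤ C * Real.exp (n * (1 / (i + 1)))}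
  zero_mem' := ⟨0, fun n => by simp⟩
  add_mem' := by
    rintro a b ⟨C, hC⟩ ⟨D, hD⟩
    refine ⟨C + D, fun n => ?_⟩
    rw [map_add, add_mul]
    exact (norm_add_le _ _).trans (add_le_add (hC n) (hD n))
  smul_mem' := by
    rintro c a ⟨C, hC⟩
    refine ⟨‖c‖ * C, fun n => ?_⟩
    rw [map_smul, norm_smul, mul_assoc]
    exact mul_le_mul_of_nonneg_left (hC n) (norm_nonneg _)

theorem mem_Vsub {i : ℕ} {x : α} {w : EE p} : w ∈ Vsub T A i x ↔
    ∃ C : ℝ, ∀ n : ℕ, ‖cocycleIter T A n x w‖ ≤ C * Real.exp (n * (1 / (i + 1))) := Iff.rfl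

theorem Vsub_anti (x : α) : Antitone fun i => Vsub T A i x := by
  intro i j hij w hw
  simp only at hw ⊢
  rw [mem_Vsub] at hw ⊢
  obtain ⟨C, hC⟩ := hw
  have hC0 : 0 ≤ C := by
    have := (norm_nonneg _).trans (hC 0)
    simpa using this
  refine ⟨C, fun n => (hC n).trans ?_⟩
  have : (1 : ℝ) / (j + 1) ≤ 1 / (i + 1) := by
    apply one_div_le_one_div_of_le (by positivity)
    have : (i : ℝ) ≤ j := by exact_mod_cast hij
    linarith
  gcongr

theorem Vsub_shift (i : ℕ) (x : α) (w : EE p) : A x w ∈ Vsub T A i (T x) ↔ w ∈ Vsub T A i x := by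
  rw [mem_Vsub, mem_Vsub]
  have hs : ∀ n, cocycleIter T A n (T x) (A x w) = cocycleIter T A (n + 1) x w := fun n => rfl
  simp only [hs]
  constructor
  · rintro ⟨C, hC⟩
    have hC0 : 0 ≤ C := by
      have := (norm_nonneg _).trans (hC 0)
      simpa using this
    refine ⟨C + ‖w‖, fun n => ?_⟩
    cases n with
    | zero => simpa [cocycle_zero] using hC0
    | succ n =>
      refine (hC n).trans ?_
      have h1 : C ≤ C + ‖w‖ := by linarith [norm_nonneg w]
      have h2 : (n : ℝ) ≤ (n + 1 : ℕ) := by push_cast; linarith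
      gcongr
  · rintro ⟨C, hC⟩
    refine ⟨C * Real.exp (1 / (i + 1)), fun n => (hC (n + 1)).trans (le_of_eq ?_)⟩
    rw [mul_assoc, ← Real.exp_add]; congr 2; push_cast; ring

theorem Vsub_central (x : α) (w : EE p) (h : ∀ i, w ∈ Vsub T A i x) : w ∈ centralStable T A x := by
  show limsup (fun n : ℕ => ‖cocycleIter T A n x w‖ ^ ((1 : ℝ) / n)) atTop ≤ 1
  apply le_of_forall_gt_imp_ge_of_dense
  intro a ha
  have hcob : IsCoboundedUnder (· ≤ ·) atTop (fun n : ℕ => ‖cocycleIter T A n x w‖ ^ ((1 : ℝ) / n)) :=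
    IsBoundedUnder.isCoboundedUnder_le
      (isBoundedUnder_of ⟨0, fun n => Real.rpow_nonneg (norm_nonneg _) _⟩)
  apply limsup_le_of_le hcob
  have hla : 0 < Real.log a := Real.log_pos ha
  obtain ⟨i, hi⟩ := exists_nat_one_div_lt hla
  obtain ⟨C, hC⟩ := mem_Vsub.mp (h i)
  set D := max C 1
  have hD : 0 < D := lt_of_lt_of_le one_pos (le_max_right _ _)
  have hlim : Tendsto (fun n : ℕ => D ^ ((1 : ℝ) / n) * Real.exp (1 / (i + 1))) atTop
      (nhds (D ^ (0 : ℝ) * Real.exp (1 / (i + 1)))) := by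
    apply Tendsto.mul_const
    exact ((Real.continuous_const_rpow hD.ne').tendsto 0).comp tendsto_one_div_atTop_nhds_zero_nat
  have hlt : D ^ (0 : ℝ) * Real.exp (1 / (i + 1)) < a := by
    rw [Real.rpow_zero, one_mul, ← Real.exp_log (show 0 < a by linarith)]
    exact Real.exp_lt_exp.mpr hi
  filter_upwards [hlim.eventually_lt_const hlt, eventually_ge_atTop 1] with n hn hn1
  refine le_trans ?_ hn.le
  have hn0 : (n : ℝ) ≠ 0 := by positivity
  calc ‖cocycleIter T A n x w‖ ^ ((1 : ℝ) / n) ≤ (D * Real.exp (n * (1 / (i + 1)))) ^ ((1 : ℝ) / n) := by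
        apply Real.rpow_le_rpow (norm_nonneg _) _ (by positivity)
        refine (hC n).trans ?_
        gcongr
        exact le_max_left _ _
    _ = _ := by
        rw [Real.mul_rpow hD.le (Real.exp_nonneg _), ← Real.exp_mul]
        congr 2; field_simp

namespace Sys

theorem Q_exists (S : Sys μ T A b Θ K M P) : ∃ i : ℕ, μ {x | ∀ j, Vsub T A i x ≤ Vsub T A j x} = 1 := by
  have := S.prob
  set Q : ℕ → Set α := fun i => {x | ∀ j, Vsub T A i x ≤ Vsub T A j x} with hQ
  have hmono : Monotone Q := by
    intro i i' h x hx j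
    exact (Vsub_anti x h).trans (hx j)
  have huniv : ⋃ i, Q i = Set.univ := by
    rw [Set.eq_univ_iff_forall]
    intro x
    rw [Set.mem_iUnion]
    let f : ℕ →o (Submodule ℝ (EE p))ᵒᵈ := ⟨fun i => OrderDual.toDual (Vsub T A i x), fun i j h => Vsub_anti x h⟩
    obtain ⟨i, hi⟩ := IsArtinian.monotone_stabilizes f
    refine ⟨i, fun j => ?_⟩
    rcases le_total i j with h | h
    · have : Vsub T A i x = Vsub T A j x := hi j h
      rw [this]
    · exact Vsub_anti x h
  have hinv : ∀ i, T ⁻¹' (Q i) = Q i := by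
    intro i; ext x
    constructor
    · intro hx j w hw
      have := hx j ((Vsub_shift i x w).mpr hw)
      exact (Vsub_shift j x w).mp this
    · intro hx j w hw
      obtain ⟨w', rfl⟩ := (A x).surjective w
      exact (Vsub_shift j x w').mpr (hx j ((Vsub_shift i x w').mp hw))
  by_contra hcon
  push Not at hcon
  have h0 : ∀ i, μ (Q i) = 0 := fun i => (outer_zero_one S.erg (hinv i)).resolve_right (hcon i)
  have : μ (⋃ i, Q i) = 0 := measure_iUnion_null h0
  rw [huniv, measure_univ] at this
  exact one_ne_zero this

theorem central_point (S : Sys μ T A b Θ K M P) {x : α} {v u : EE p} (hv : v ∈ cone Θ) {c ε C1 C2 C3 : ℝ}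
    (hε : 0 < ε) (hcε : 3 * ε ≤ c) (hC1 : 0 ≤ C1) (hC3 : 0 ≤ C3)
    (h1 : ∀ n j : ℕ, ‖cocycleIter T A n x v‖ ≤
      C1 * Real.exp (ε * n) * Real.exp (-c * j) * ‖cocycleIter T A (n + j) x v‖)
    (h2 : ∀ n : ℕ, b (T^[n] x) ≤ ε * n + C2)
    (h3 : ∀ n : ℕ, dl (cocycleIter T A n x v) (cocycleIter T A n x u) ≤ C3 * Real.exp (ε * n)) :
    ∃ t : ℝ, ∃ C : ℝ, ∀ n : ℕ, ‖cocycleIter T A n x (u + t • v)‖ ≤ C * Real.exp (3 * ε * n) := by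
  have hv0 : 0 < ‖v‖ := norm_pos_iff.mpr (S.cone_ne hv)
  choose t ht using fun j => dl_attain (cocycleIter T A j x v) (cocycleIter T A j x u)
  have ht' : ∀ j, ‖cocycleIter T A j x (u + t j • v)‖ ≤ C3 * Real.exp (ε * j) := by
    intro j
    rw [map_add, map_smul, ← ht j]; exact h3 j
  set C4 := C3 + C3 * Real.exp (C2 + ε) with hC4
  have hstep : ∀ j, ‖(t j - t (j + 1)) • cocycleIter T A j x v‖ ≤ C4 * Real.exp (2 * ε * j) := by
    intro j
    have e : (t j - t (j + 1)) • cocycleIter T A j x v =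
        cocycleIter T A j x (u + t j • v) - cocycleIter T A j x (u + t (j + 1) • v) := by
      simp only [map_add, map_smul, sub_smul]; abel
    rw [e]
    refine (norm_sub_le _ _).trans ?_
    have hb := S.blb (T^[j] x) (cocycleIter T A j x (u + t (j + 1) • v))
    rw [← cocycle_succ'] at hb
    have q1 := ht' j
    have q2 := ht' (j + 1)
    have q3 : Real.exp (b (T^[j] x)) ≤ Real.exp (ε * j + C2) := Real.exp_le_exp.mpr (h2 j)
    have q4 : Real.exp (ε * j) ≤ Real.exp (2 * ε * j) := by
      apply Real.exp_le_exp.mpr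
      have : 0 ≤ ε * j := by positivity
      linarith
    calc _ ≤ C3 * Real.exp (ε * j) + Real.exp (ε * j + C2) * (C3 * Real.exp (ε * (j + 1 : ℕ))) := by
          apply add_le_add q1
          refine hb.trans ?_
          gcongr
      _ = C3 * Real.exp (ε * j) + C3 * Real.exp (C2 + ε) * Real.exp (2 * ε * j) := by
          congr 1
          rw [mul_left_comm, ← Real.exp_add, mul_assoc, ← Real.exp_add]; congr 2; push_cast; ring
      _ ≤ C3 * Real.exp (2 * ε * j) + C3 * Real.exp (C2 + ε) * Real.exp (2 * ε * j) := by gcongr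
      _ = _ := by rw [hC4]; ring
  have hC40 : 0 ≤ C4 := by positivity
  have hstep2 : ∀ n i : ℕ, ‖(t (n + i) - t (n + i + 1)) • cocycleIter T A n x v‖ ≤
      C1 * C4 * Real.exp (3 * ε * n) * Real.exp (-ε) ^ i := by
    intro n i
    have q := hstep (n + i)
    rw [norm_smul] at q ⊢
    calc _ ≤ ‖t (n + i) - t (n + i + 1)‖ * (C1 * Real.exp (ε * n) * Real.exp (-c * i) * ‖cocycleIter T A (n + i) x v‖) := by
          gcongr; exact h1 n i
      _ = C1 * Real.exp (ε * n) * Real.exp (-c * i) * (‖t (n + i) - t (n + i + 1)‖ * ‖cocycleIter T A (n + i) x v‖) := by ring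
      _ ≤ C1 * Real.exp (ε * n) * Real.exp (-c * i) * (C4 * Real.exp (2 * ε * (n + i : ℕ))) := by gcongr
      _ = C1 * C4 * Real.exp (ε * n + -c * i + 2 * ε * (n + i : ℕ)) := by
          rw [Real.exp_add, Real.exp_add]; ring
      _ ≤ C1 * C4 * Real.exp (3 * ε * n + i * -ε) := by
          apply mul_le_mul_of_nonneg_left _ (mul_nonneg hC1 hC40)
          apply Real.exp_le_exp.mpr
          push_cast
          have : (3 * ε) * i ≤ c * i := by gcongr
          linarith
      _ = _ := by rw [Real.exp_add, Real.exp_nat_mul]; ring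
  have hr : Real.exp (-ε) < 1 := by simpa using hε
  have hdist : ∀ j, dist (t j) (t (j + 1)) ≤ (C1 * C4 / ‖v‖) * Real.exp (-ε) ^ j := by
    intro j
    have := hstep2 0 j
    simp only [zero_add, cocycle_zero, norm_smul, Nat.cast_zero, mul_zero, Real.exp_zero, mul_one] at this
    rw [Real.dist_eq, ← Real.norm_eq_abs, div_mul_eq_mul_div, le_div_iff₀ hv0]
    exact this
  obtain ⟨t0, ht0⟩ := cauchySeq_tendsto_of_complete (cauchySeq_of_le_geometric _ _ hr hdist)
  refine ⟨t0, C3 + C1 * C4 / (1 - Real.exp (-ε)), fun n => ?_⟩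
  have hlim : Tendsto (fun i => cocycleIter T A n x (u + t (n + i) • v)) atTop
      (nhds (cocycleIter T A n x (u + t0 • v))) := by
    apply ((cocycleIter T A n x).continuous.tendsto _).comp
    apply Tendsto.const_add
    apply Tendsto.smul_const
    have := (tendsto_add_atTop_iff_nat n).mpr ht0
    simpa [add_comm] using this
  have hd : ∀ i, dist (cocycleIter T A n x (u + t (n + i) • v)) (cocycleIter T A n x (u + t (n + (i + 1)) • v)) ≤
      C1 * C4 * Real.exp (3 * ε * n) * Real.exp (-ε) ^ i := by
    intro i
    rw [dist_eq_norm]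
    refine le_trans (le_of_eq ?_) (hstep2 n i)
    congr 1
    simp only [map_add, map_smul, sub_smul, add_assoc]; abel
  have := dist_le_of_le_geometric_of_tendsto₀ _ _ hr hd hlim
  rw [add_zero, dist_eq_norm] at this
  have q1 := ht' n
  have q4 : Real.exp (ε * n) ≤ Real.exp (3 * ε * n) := by
    apply Real.exp_le_exp.mpr
    have : 0 ≤ ε * n := by positivity
    linarith
  have q5 := norm_le_norm_add_norm_sub' (cocycleIter T A n x (u + t0 • v)) (cocycleIter T A n x (u + t n • v))
  rw [norm_sub_rev] at q5
  have q6 : C3 * Real.exp (ε * n) ≤ C3 * Real.exp (3 * ε * n) := by gcongr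
  rw [add_mul, div_mul_eq_mul_div]
  linarith

theorem hcs_cone (S : Sys μ T A b Θ K M P) {v u : EE p} (hv : v ∈ cone Θ) (hd : 0 < dl v u) :
    ∀ᵐ x ∂μ, ∀ t : ℝ, u + t • v ∉ centralStable T A x := by
  obtain ⟨c, hc, w, hw, rfl⟩ := hv
  rw [dl_smul_left _ _ hc] at hd
  filter_upwards [S.hcs w hw u (dl_pos_iff.mp hd)] with x hx t ht
  have : u + t • c • w ∈ lineDir w u ∩ centralStable T A x := ⟨⟨t * c, by rw [smul_smul]⟩, ht⟩
  rw [hx] at this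
  exact this

theorem lemA (S : Sys μ T A b Θ K M P) : ∃ l > 0, ∀ v ∈ cone Θ, ∀ u, 0 < dl v u →
    ∀ᵐ x ∂μ, ∃ k : ℕ, 1 ≤ k ∧ Real.exp (l * k) * dl v u < dl (cocycleIter T A k x v) (cocycleIter T A k x u) := by
  have := S.prob
  obtain ⟨i, hi⟩ := S.Q_exists
  obtain ⟨c, hc, hvae⟩ := S.v_ae
  set ε := min (1 / (3 * ((i : ℝ) + 1))) (c / 3) with hε
  have hε0 : 0 < ε := lt_min (by positivity) (by positivity)
  have hε1 : 3 * ε ≤ c := by have := min_le_right (1 / (3 * ((i : ℝ) + 1))) (c / 3); linarith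
  have hε2 : 3 * ε ≤ 1 / (i + 1) := by
    have := min_le_left (1 / (3 * ((i : ℝ) + 1))) (c / 3)
    have e : 3 * (1 / (3 * ((i : ℝ) + 1))) = 1 / (i + 1) := by field_simp
    linarith
  refine ⟨ε, hε0, fun v hv u hd => ?_⟩
  set G : Set α := {x | ∃ k : ℕ, 1 ≤ k ∧ Real.exp (ε * k) * dl v u < dl (cocycleIter T A k x v) (cocycleIter T A k x u)} with hG
  have hGm : MeasurableSet G := by
    have : G = ⋃ k : ℕ, ⋃ _ : 1 ≤ k, {x | Real.exp (ε * k) * dl v u < dl (cocycleIter T A k x v) (cocycleIter T A k x u)} := by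
      ext x; simp [hG]
    rw [this]
    exact MeasurableSet.iUnion fun k => MeasurableSet.iUnion fun _ =>
      measurableSet_lt measurable_const (S.dl_meas k v u)
  have key : ∀ᵐ x ∂μ, x ∈ {x | ∀ j, Vsub T A i x ≤ Vsub T A j x} → x ∈ G := by
    filter_upwards [hvae ε hε0 v hv, S.b_ae hε0, S.hcs_cone hv hd] with x hx1 hx2 hx3 hQ
    by_contra hcon
    have hcon' : ∀ k : ℕ, 1 ≤ k → dl (cocycleIter T A k x v) (cocycleIter T A k x u) ≤ Real.exp (ε * k) * dl v u := by
      intro k hk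
      by_contra h
      exact hcon ⟨k, hk, not_le.mp h⟩
    obtain ⟨C1, hC1, h1⟩ := hx1
    obtain ⟨C2, hC2, h2⟩ := hx2
    have h3 : ∀ n : ℕ, dl (cocycleIter T A n x v) (cocycleIter T A n x u) ≤ dl v u * Real.exp (ε * n) := by
      intro n
      rcases Nat.eq_zero_or_pos n with rfl | hn
      · simp [cocycle_zero]
      · rw [mul_comm]; exact hcon' n hn
    obtain ⟨t, C, ht⟩ := S.central_point hv hε0 hε1 hC1 (dl_nonneg v u) h1 h2 h3
    refine hx3 t (Vsub_central x _ fun j => hQ j ?_)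
    rw [mem_Vsub]
    have hC0 : 0 ≤ C := by
      have := (norm_nonneg _).trans (ht 0)
      simpa using this
    refine ⟨C, fun n => (ht n).trans ?_⟩
    apply mul_le_mul_of_nonneg_left _ hC0
    apply Real.exp_le_exp.mpr
    rw [mul_comm]
    exact mul_le_mul_of_nonneg_left hε2 (Nat.cast_nonneg n)
  have h1 : 1 ≤ μ G := by
    rw [← hi]; exact measure_mono_ae key
  have h2 : μ Gᶜ = 0 := by
    rw [prob_compl_eq_zero_iff hGm]; exact le_antisymm prob_le_one h1
  exact h2

end Sys
end

open MeasureTheory Filter Metric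
open scoped BigOperators ENNReal
set_option linter.unusedSectionVars false

theorem dl_tendsto {p : ℕ} {f g : ℕ → EE p} {v u : EE p} (hv : v ≠ 0) (hf : Tendsto f atTop (nhds v))
    (hg : Tendsto g atTop (nhds u)) : Tendsto (fun j => dl (f j) (g j)) atTop (nhds (dl v u)) := by
  unfold dl
  have hv' : ‖v‖ ^ 2 ≠ 0 := pow_ne_zero 2 (norm_ne_zero_iff.mpr hv)
  have h1 : Tendsto (fun j => inner ℝ (f j) (g j) / ‖f j‖ ^ 2) atTop (nhds (inner ℝ v u / ‖v‖ ^ 2)) :=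
    (hf.inner hg).div (hf.norm.pow 2) hv'
  exact (hg.sub (h1.smul hf)).norm

theorem tiling (y B w : ℕ → ℝ) (l : ℝ) (hl : 0 ≤ l) (n L : ℕ) (hB : ∀ k, y k - B k ≤ y (k + 1))
    (hw0 : ∀ k, 0 ≤ w k)
    (hw : ∀ k, w k = B k + l ∨ (k + n < L ∧ ∃ j, 1 ≤ j ∧ j ≤ n ∧ y k + l * j ≤ y (k + j))) :
    y 0 + l * L - ∑ k ∈ Finset.range L, w k ≤ y L := by
  have key : ∀ m a, a + m = L → y a + l * m - ∑ k ∈ Finset.Ico a L, w k ≤ y L := by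
    intro m
    induction m using Nat.strong_induction_on with
    | _ m ih =>
    intro a ha
    rcases Nat.eq_zero_or_pos m with rfl | hm
    · obtain rfl : a = L := by omega
      simp
    · rcases hw a with h | ⟨h1, j, hj1, hj2, hj⟩
      · have := ih (m - 1) (by omega) (a + 1) (by omega)
        rw [Finset.sum_eq_sum_Ico_succ_bot (by omega), h]
        have hb := hB a
        rw [Nat.cast_sub hm] at this
        push_cast at this
        linarith
      · have := ih (m - j) (by omega) (a + j) (by omega)
        rw [Nat.cast_sub (by omega)] at this
        have hs : ∑ k ∈ Finset.Ico (a + j) L, w k ≤ ∑ k ∈ Finset.Ico a L, w k :=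
          Finset.sum_le_sum_of_subset_of_nonneg (Finset.Ico_subset_Ico (by omega) le_rfl) fun k _ _ => hw0 k
        linarith
  have := key L 0 (by omega)
  rwa [← Finset.range_eq_Ico] at this

section
variable {α : Type*} [MeasurableSpace α] {p : ℕ} {μ : Measure α} {T : α → α}
    {A : α → (EE p ≃L[ℝ] EE p)} {b : α → ℝ} {Θ : Set (EE p)} {K : ℝ≥0∞}
    {M : Measure α → Prop} {P : (k : ℕ) → (Fin k → ℤ) → Set α}

/-- Points where the line has not expanded at rate `l` up to time `n`. -/
def badC (T : α → α) (A : α → (EE p ≃L[ℝ] EE p)) (l : ℝ) (n : ℕ) (v u : EE p) : Set α :=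
  {x | ∀ k : ℕ, 1 ≤ k → k ≤ n →
    dl (cocycleIter T A k x v) (cocycleIter T A k x u) ≤ Real.exp (l * k) * dl v u}

namespace Sys

theorem badC_meas (S : Sys μ T A b Θ K M P) (l : ℝ) (n : ℕ) (v u : EE p) :
    MeasurableSet (badC T A l n v u) := by
  have : badC T A l n v u = ⋂ k : ℕ, ⋂ _ : 1 ≤ k, ⋂ _ : k ≤ n,
      {x | dl (cocycleIter T A k x v) (cocycleIter T A k x u) ≤ Real.exp (l * k) * dl v u} := by
    ext x; simp [badC]
  rw [this]
  exact MeasurableSet.iInter fun k => MeasurableSet.iInter fun _ => MeasurableSet.iInter fun _ =>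
    measurableSet_le (S.dl_meas k v u) measurable_const

theorem lemC (S : Sys μ T A b Θ K M P) {l : ℝ} (hA : ∀ v ∈ cone Θ, ∀ u, 0 < dl v u →
    ∀ᵐ x ∂μ, ∃ k : ℕ, 1 ≤ k ∧ Real.exp (l * k) * dl v u < dl (cocycleIter T A k x v) (cocycleIter T A k x u))
    {η : ℝ≥0∞} (hη : 0 < η) : ∃ n, ∀ v ∈ cone Θ, ∀ u, 0 < dl v u → μ (badC T A l n v u) ≤ η := by
  have := S.prob
  set Y : Set (EE p × EE p) := (Θ ×ˢ sphere (0 : EE p) 1) ∩ (fun q : EE p × EE p => dl q.1 q.2) ⁻¹' {1} with hY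
  have hcomp : IsCompact (Θ ×ˢ sphere (0 : EE p) 1) := S.Θcomp.prod (isCompact_sphere _ _)
  have hne : ∀ v ∈ Θ, v ≠ 0 := fun v hv h => S.Θ0 (h ▸ hv)
  have hYc : IsCompact Y := by
    refine hcomp.of_isClosed_subset ?_ Set.inter_subset_left
    refine ContinuousOn.preimage_isClosed_of_isClosed ?_ hcomp.isClosed isClosed_singleton
    intro q hq
    exact (dl_continuousAt (v := q.1) (u := q.2) (hne _ hq.1)).continuousWithinAt
  have hdini : ∃ n, ∀ q ∈ Y, μ (badC T A l n q.1 q.2) ≤ η := by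
    refine dini_sets (μ := μ) hYc (fun n q => badC T A l n q.1 q.2) (fun n q _ => S.badC_meas _ _ _ _) ?_ ?_ ?_ hη
    · intro q m n hmn x hx k hk1 hk2
      exact hx k hk1 (hk2.trans hmn)
    · intro n q hq f hf hlim x hx k hk1 hk2
      have l1 : Tendsto (fun j => (f j).1) atTop (nhds q.1) := (continuous_fst.tendsto q).comp hlim
      have l2 : Tendsto (fun j => (f j).2) atTop (nhds q.2) := (continuous_snd.tendsto q).comp hlim
      have hqc : q.1 ∈ cone Θ := ⟨1, one_ne_zero, q.1, hq.1.1, by simp⟩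
      have c1 := dl_tendsto (hne _ hq.1.1) l1 l2
      have m1 : Tendsto (fun j => cocycleIter T A k x (f j).1) atTop (nhds (cocycleIter T A k x q.1)) :=
        ((cocycleIter T A k x).continuous.tendsto _).comp l1
      have m2 : Tendsto (fun j => cocycleIter T A k x (f j).2) atTop (nhds (cocycleIter T A k x q.2)) :=
        ((cocycleIter T A k x).continuous.tendsto _).comp l2
      have c2 := dl_tendsto (S.cone_ne (S.cone_coc k x hqc)) m1 m2
      exact closed_aux c2 (c1.const_mul _) (hx.mono fun j hj => hj k hk1 hk2)
    · intro q hq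
      have hqc : q.1 ∈ cone Θ := ⟨1, one_ne_zero, q.1, hq.1.1, by simp⟩
      have hq1 : dl q.1 q.2 = 1 := hq.2
      rw [measure_eq_zero_iff_ae_notMem]
      filter_upwards [hA q.1 hqc q.2 (by rw [hq1]; exact one_pos)] with x hx hmem
      obtain ⟨k, hk, hk2⟩ := hx
      have := Set.mem_iInter.mp hmem k k hk le_rfl
      linarith
  obtain ⟨n, hn⟩ := hdini
  refine ⟨n, ?_⟩
  rintro v ⟨c, hc, w, hw, rfl⟩ u hd
  rw [dl_smul_left _ _ hc] at hd
  obtain ⟨t, ht⟩ := dl_attain w u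
  set d := dl w u with hdd
  set u' := d⁻¹ • (u + t • w) with hu'
  have hdl : ∀ L : EE p ≃L[ℝ] EE p, dl (L w) (L u') = d⁻¹ * dl (L w) (L u) := by
    intro L
    rw [hu', map_smul, map_add, map_smul, dl_smul_right, dl_add_smul, abs_of_pos (inv_pos.mpr hd)]
  have h1 : dl w u' = 1 := by
    have := hdl (ContinuousLinearEquiv.refl ℝ (EE p))
    simp only [ContinuousLinearEquiv.refl_apply] at this
    rw [this, ← hdd]; field_simp
  have hmem : (w, u') ∈ Y := by
    refine ⟨⟨hw, ?_⟩, h1⟩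
    simp only [mem_sphere_iff_norm, sub_zero]
    rw [hu', norm_smul, ← ht, Real.norm_eq_abs, abs_of_pos (inv_pos.mpr hd)]; field_simp
  refine le_trans (measure_mono ?_) (hn _ hmem)
  intro x hx k hk1 hk2
  have := hx k hk1 hk2
  rw [map_smul, dl_smul_left _ _ hc, dl_smul_left _ _ hc, ← hdd] at this
  show dl _ _ ≤ _ * dl w u'
  rw [hdl, h1, mul_one, inv_mul_le_iff₀ hd, mul_comm]
  exact this

theorem lemC' (S : Sys μ T A b Θ K M P) {l : ℝ} (hA : ∀ v ∈ cone Θ, ∀ u, 0 < dl v u →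
    ∀ᵐ x ∂μ, ∃ k : ℕ, 1 ≤ k ∧ Real.exp (l * k) * dl v u < dl (cocycleIter T A k x v) (cocycleIter T A k x u))
    {κ : ℝ≥0∞} (hκ : 0 < κ) : ∃ n, ∀ v ∈ cone Θ, ∀ u, 0 < dl v u →
      ∫⁻ x in badC T A l n v u, ENNReal.ofReal (b x + l) ∂μ ≤ κ := by
  have := S.prob
  have hfin : ∫⁻ x, ENNReal.ofReal (b x + l) ∂μ ≠ ⊤ :=
    (S.bint.add (integrable_const l)).lintegral_lt_top.ne
  obtain ⟨δ, hδ, h⟩ := exists_pos_setLIntegral_lt_of_measure_lt hfin hκ.ne'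
  obtain ⟨η, hη1, hη2⟩ := exists_between hδ
  obtain ⟨n, hn⟩ := S.lemC hA hη1
  exact ⟨n, fun v hv u hd => (h _ ((hn v hv u hd).trans_lt hη2)).le⟩

theorem dl_pos_map {v u : EE p} (hd : 0 < dl v u) (L : EE p ≃L[ℝ] EE p) : 0 < dl (L v) (L u) := by
  rw [dl_pos_iff] at hd ⊢
  rintro ⟨t, ht⟩
  apply hd
  refine ⟨t, ?_⟩
  apply L.injective
  simpa using ht

theorem dl_lower (S : Sys μ T A b Θ K M P) (n : ℕ) (x : α) (v u : EE p) :
    dl v u ≤ Real.exp (bs T b n x) * dl (cocycleIter T A n x v) (cocycleIter T A n x u) :=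
  dl_map_lower _ (S.lb n x) v u

theorem dl_upper (S : Sys μ T A b Θ K M P) (n : ℕ) (x : α) (v u : EE p) :
    dl (cocycleIter T A n x v) (cocycleIter T A n x u) ≤ Real.exp (bs T b n x) * dl v u :=
  dl_map_upper _ (S.ub n x) v u

theorem dl_log (S : Sys μ T A b Θ K M P) (n : ℕ) (x : α) {v u : EE p} (hd : 0 < dl v u) :
    |Real.log (dl (cocycleIter T A n x v) (cocycleIter T A n x u)) - Real.log (dl v u)| ≤ bs T b n x := by
  have h0 := dl_pos_map hd (cocycleIter T A n x)
  have h1 := Real.log_le_log hd (S.dl_lower n x v u)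
  have h2 := Real.log_le_log h0 (S.dl_upper n x v u)
  rw [Real.log_mul (Real.exp_pos _).ne' h0.ne', Real.log_exp] at h1
  rw [Real.log_mul (Real.exp_pos _).ne' hd.ne', Real.log_exp] at h2
  rw [abs_le]; constructor <;> linarith

theorem bs_meas (S : Sys μ T A b Θ K M P) (n : ℕ) : Measurable (bs T b n) :=
  Finset.measurable_fun_sum _ fun k _ => S.bmeas.comp (S.Tm.iterate k)

theorem log_int (S : Sys μ T A b Θ K M P) (n : ℕ) {v u : EE p} (hd : 0 < dl v u) {ν : Measure α} (hν : M ν) :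
    Integrable (fun x => Real.log (dl (cocycleIter T A n x v) (cocycleIter T A n x u)) - Real.log (dl v u)) ν := by
  refine (S.int_M hν (S.bs_int n)).mono' ?_ (Eventually.of_forall fun x => S.dl_log n x hd)
  exact ((S.dl_meas n v u).log.sub measurable_const).aestronglyMeasurable

theorem lemD (S : Sys μ T A b Θ K M P) : ∃ N : ℕ, 1 ≤ N ∧ ∀ v ∈ cone Θ, ∀ u, 0 < dl v u → ∀ ν, M ν →
    2 ≤ ∫ x, (Real.log (dl (cocycleIter T A N x v) (cocycleIter T A N x u)) - Real.log (dl v u)) ∂ν := by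
  have := S.prob
  obtain ⟨l, hl, hA⟩ := S.lemA
  have hκ : (0 : ℝ≥0∞) < K⁻¹ * ENNReal.ofReal (l / 2) := by
    apply ENNReal.mul_pos
    · simpa using S.Kne
    · simpa using hl
  obtain ⟨n, hn⟩ := S.lemC' hA hκ
  have hfin : ∫⁻ x, ENNReal.ofReal (b x + l) ∂μ ≠ ⊤ :=
    (S.bint.add (integrable_const l)).lintegral_lt_top.ne
  set I := K * ∫⁻ x, ENNReal.ofReal (b x + l) ∂μ with hI
  have hIfin : I ≠ ⊤ := ENNReal.mul_ne_top S.Kne hfin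
  obtain ⟨N, hN⟩ := exists_nat_ge ((2 + n * I.toReal) / (l / 2))
  rw [div_le_iff₀ (by positivity)] at hN
  have hN1 : 1 ≤ N := by
    by_contra h
    have : N = 0 := by omega
    subst this
    have : 0 ≤ n * I.toReal := by positivity
    simp at hN; linarith
  refine ⟨N, hN1, fun v hv u hd ν hν => ?_⟩
  have := S.Mprob ν hν
  set Y : α → ℝ := fun x => Real.log (dl (cocycleIter T A N x v) (cocycleIter T A N x u)) - Real.log (dl v u) with hY
  have hYint : Integrable Y ν := S.log_int N hd hν
  set Bd : ℕ → Set α := fun k => {x | T^[k] x ∈ badC T A l n (cocycleIter T A k x v) (cocycleIter T A k x u)} with hBd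
  have hBdm : ∀ k, MeasurableSet (Bd k) := by
    intro k
    have : Bd k = ⋂ j : ℕ, ⋂ _ : 1 ≤ j, ⋂ _ : j ≤ n,
      {x | dl (cocycleIter T A (k + j) x v) (cocycleIter T A (k + j) x u) ≤
        Real.exp (l * j) * dl (cocycleIter T A k x v) (cocycleIter T A k x u)} := by
      ext x; simp [hBd, badC, cocycle_add]
    rw [this]
    exact MeasurableSet.iInter fun j => MeasurableSet.iInter fun _ => MeasurableSet.iInter fun _ =>
      measurableSet_le (S.dl_meas _ v u) ((S.dl_meas k v u).const_mul _)
  have hbk : ∀ k, Measurable fun x => ENNReal.ofReal (b (T^[k] x) + l) := fun k =>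
    ((S.bmeas.comp (S.Tm.iterate k)).add_const l).ennreal_ofReal
  -- pathwise bound
  have hpath : ∀ x, ENNReal.ofReal (l * N - Y x) ≤
      ∑ k ∈ Finset.range N, ((Bd k).indicator (fun x => ENNReal.ofReal (b (T^[k] x) + l)) x +
        (if N ≤ k + n then ENNReal.ofReal (b (T^[k] x) + l) else 0)) := by
    intro x
    classical
    set w : ℕ → ℝ := fun k => if x ∈ Bd k ∨ N ≤ k + n then b (T^[k] x) + l else 0 with hw
    have hw0 : ∀ k, 0 ≤ w k := by
      intro k; simp only [hw]; split_ifs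
      · have := S.bnn (T^[k] x); linarith
      · exact le_rfl
    have ht := tiling (fun k => Real.log (dl (cocycleIter T A k x v) (cocycleIter T A k x u)))
      (fun k => b (T^[k] x)) w l hl.le n N ?_ hw0 ?_
    · calc ENNReal.ofReal (l * N - Y x) ≤ ENNReal.ofReal (∑ k ∈ Finset.range N, w k) := by
            apply ENNReal.ofReal_le_ofReal
            simp only [hY, cocycle_zero] at ht ⊢; linarith
        _ = ∑ k ∈ Finset.range N, ENNReal.ofReal (w k) := ENNReal.ofReal_sum_of_nonneg fun k _ => hw0 k
        _ ≤ _ := by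
            apply Finset.sum_le_sum
            intro k _
            simp only [hw]
            by_cases h1 : x ∈ Bd k
            · simp only [h1, true_or, if_true, Set.indicator_of_mem]; exact le_self_add
            · by_cases h2 : N ≤ k + n
              · simp [h1, h2]
              · simp [h1, h2]
    · intro k
      have hk := dl_pos_map hd (cocycleIter T A k x)
      have := S.dl_log 1 (T^[k] x) hk
      rw [← cocycle_add, ← cocycle_add, abs_le] at this
      have e : bs T b 1 (T^[k] x) = b (T^[k] x) := by simp [bs]
      rw [e] at this
      linarith [this.1]
    · intro k
      by_cases h : x ∈ Bd k ∨ N ≤ k + n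
      · left; simp [hw, h]
      · right
        push Not at h
        refine ⟨h.2, ?_⟩
        have h1 : ¬ ∀ j : ℕ, 1 ≤ j → j ≤ n → _ := h.1
        push Not at h1
        obtain ⟨j, hj1, hj2, hj⟩ := h1
        refine ⟨j, hj1, hj2, ?_⟩
        rw [← cocycle_add, ← cocycle_add] at hj
        have hk := dl_pos_map hd (cocycleIter T A k x)
        have := Real.log_le_log (by positivity) hj.le
        rw [Real.log_mul (Real.exp_pos _).ne' hk.ne', Real.log_exp] at this
        linarith
  have hterm : ∀ k, ∫⁻ x, (Bd k).indicator (fun x => ENNReal.ofReal (b (T^[k] x) + l)) x ∂ν ≤ ENNReal.ofReal (l / 2) := by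
    intro k
    have key := S.dec hν k (fun x y => (badC T A l n (cocycleIter T A k x v) (cocycleIter T A k x u)).indicator
      (fun y => ENNReal.ofReal (b y + l)) y) (fun _ => ENNReal.ofReal (l / 2)) ?_ ?_ ?_
    · rw [lintegral_const, measure_univ, mul_one] at key
      exact key
    · intro x
      exact ((S.bmeas.add_const l).ennreal_ofReal).indicator (S.badC_meas _ _ _ _)
    · intro f x hx y hy
      rw [cocycle_congr T A k x y (S.PA k f x hx y hy)]
    · intro x ν' hν'
      refine (S.lint_le hν' _).trans ?_
      rw [lintegral_indicator (S.badC_meas _ _ _ _)]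
      calc _ ≤ K * (K⁻¹ * ENNReal.ofReal (l / 2)) := by
            gcongr
            exact hn _ (S.cone_coc k x hv) _ (dl_pos_map hd _)
        _ = _ := by rw [← mul_assoc, ENNReal.mul_inv_cancel S.K0 S.Kne, one_mul]
  have hterm2 : ∀ k, ∫⁻ x, ENNReal.ofReal (b (T^[k] x) + l) ∂ν ≤ I := by
    intro k
    refine (S.lint_le hν _).trans ?_
    rw [hI, S.lint_iter k (f := fun x => ENNReal.ofReal (b x + l)) ((S.bmeas.add_const l).ennreal_ofReal).aemeasurable]
  have htot : ∫⁻ x, ENNReal.ofReal (l * N - Y x) ∂ν ≤ ENNReal.ofReal (N * (l / 2) + n * I.toReal) := by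
    calc _ ≤ ∫⁻ x, ∑ k ∈ Finset.range N, ((Bd k).indicator (fun x => ENNReal.ofReal (b (T^[k] x) + l)) x +
        (if N ≤ k + n then ENNReal.ofReal (b (T^[k] x) + l) else 0)) ∂ν := lintegral_mono hpath
      _ = ∑ k ∈ Finset.range N, ((∫⁻ x, (Bd k).indicator (fun x => ENNReal.ofReal (b (T^[k] x) + l)) x ∂ν) +
        (if N ≤ k + n then ∫⁻ x, ENNReal.ofReal (b (T^[k] x) + l) ∂ν else 0)) := by
          rw [lintegral_finsetSum]
          · apply Finset.sum_congr rfl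
            intro k _
            rw [lintegral_add_left ((hbk k).indicator (hBdm k))]
            split_ifs <;> simp
          · intro k _
            apply Measurable.add ((hbk k).indicator (hBdm k))
            split_ifs
            · exact hbk k
            · exact measurable_const
      _ ≤ ∑ k ∈ Finset.range N, (ENNReal.ofReal (l / 2) + (if N ≤ k + n then I else 0)) := by
          apply Finset.sum_le_sum
          intro k _
          apply add_le_add (hterm k)
          split_ifs
          · exact hterm2 k
          · exact le_rfl
      _ ≤ N * ENNReal.ofReal (l / 2) + n * I := by
          rw [Finset.sum_add_distrib, Finset.sum_const, Finset.card_range, nsmul_eq_mul,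
            ← Finset.sum_filter, Finset.sum_const, nsmul_eq_mul]
          gcongr
          have hsub : Finset.filter (fun k => N ≤ k + n) (Finset.range N) ⊆ Finset.Ico (N - n) N := by
            intro k hk
            simp only [Finset.mem_filter, Finset.mem_range, Finset.mem_Ico] at hk ⊢
            omega
          refine (Finset.card_le_card hsub).trans ?_
          rw [Nat.card_Ico]; omega
      _ = _ := by
          rw [ENNReal.ofReal_add (by positivity) (by positivity), ENNReal.ofReal_mul (by positivity),
            ENNReal.ofReal_mul (by positivity), ENNReal.ofReal_toReal hIfin]
          simp
  have hint2 : Integrable (fun x => l * N - Y x) ν := (integrable_const _).sub hYint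
  have h1 : ∫ x, (l * N - Y x) ∂ν ≤ N * (l / 2) + n * I.toReal := by
    have h2 : ∫ x, (l * N - Y x) ∂ν ≤ ∫ x, max (l * N - Y x) 0 ∂ν :=
      integral_mono hint2 hint2.pos_part fun x => le_max_left _ _
    refine h2.trans ?_
    rw [integral_eq_lintegral_of_nonneg_ae (f := fun x => max (l * N - Y x) 0)
      (Eventually.of_forall fun x => le_max_right _ _)
      hint2.pos_part.aestronglyMeasurable]
    apply ENNReal.toReal_le_of_le_ofReal (by positivity)
    simpa using htot
  rw [integral_sub (integrable_const _) hYint, integral_const, probReal_univ, one_smul] at h1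
  linarith

end Sys
end

open MeasureTheory Filter Metric
open scoped BigOperators ENNReal
set_option linter.unusedSectionVars false

theorem exp_quad {z : ℝ} (hz : |z| ≤ 1) : Real.exp z ≤ 1 + z + z ^ 2 := by
  have h := Real.abs_exp_sub_one_sub_id_le hz
  have := (abs_le.mp h).2
  linarith

section
variable {α : Type*} [MeasurableSpace α] {p : ℕ} {μ : Measure α} {T : α → α}
    {A : α → (EE p ≃L[ℝ] EE p)} {b : α → ℝ} {Θ : Set (EE p)} {K : ℝ≥0∞}
    {M : Measure α → Prop} {P : (k : ℕ) → (Fin k → ℤ) → Set α}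
namespace Sys

theorem tail (S : Sys μ T A b Θ K M P) (N : ℕ) {ε : ℝ} (hε : 0 < ε) : ∃ Mz : ℝ, 1 ≤ Mz ∧
    ∫ x, {x | Mz < bs T b N x}.indicator (fun x => bs T b N x + 1 / 2) x ∂μ < ε := by
  have := S.prob
  have hlim : Tendsto (fun n : ℕ => ∫ x, {x | (n : ℝ) < bs T b N x}.indicator (fun x => bs T b N x + 1 / 2) x ∂μ)
      atTop (nhds (∫ x, (0 : ℝ) ∂μ)) := by
    apply tendsto_integral_of_dominated_convergence (fun x => bs T b N x + 1 / 2)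
    · intro n
      exact (((S.bs_meas N).add_const _).indicator (measurableSet_lt measurable_const (S.bs_meas N))).aestronglyMeasurable
    · exact (S.bs_int N).add (integrable_const _)
    · intro n
      refine Eventually.of_forall fun x => ?_
      have h0 := S.bs_nn N x
      refine (norm_indicator_le_norm_self _ _).trans ?_
      rw [Real.norm_eq_abs, abs_of_nonneg (by linarith)]
    · refine Eventually.of_forall fun x => ?_
      obtain ⟨n0, hn0⟩ := exists_nat_ge (bs T b N x)
      apply tendsto_const_nhds.congr'
      filter_upwards [eventually_ge_atTop n0] with n hn
      rw [Set.indicator_of_notMem]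
      have : (n0 : ℝ) ≤ n := by exact_mod_cast hn
      simp only [Set.mem_ofPred_eq, not_lt]; linarith
  rw [integral_zero] at hlim
  obtain ⟨n, hn, hn1⟩ := ((hlim.eventually_lt_const hε).and (eventually_ge_atTop 1)).exists
  exact ⟨n, by exact_mod_cast hn1, hn⟩

theorem one_step (S : Sys μ T A b Θ K M P) : ∃ N : ℕ, 1 ≤ N ∧ ∃ Mz : ℝ, 1 ≤ Mz ∧ ∃ ρ > 0,
    ∫ x, {x | Mz < bs T b N x}.indicator (fun x => bs T b N x + 1 / 2) x ∂μ ≤ 1 / (16 * N) ∧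
    ∀ v ∈ cone Θ, ∀ u, 0 < dl v u → ∀ ν, M ν →
      ∫⁻ x in {x | bs T b N x ≤ Mz},
        ENNReal.ofReal (dl (cocycleIter T A N x v) (cocycleIter T A N x u) ^ (-ρ)) ∂ν ≤
      ν {x | bs T b N x ≤ Mz} * ENNReal.ofReal (dl v u ^ (-ρ) * Real.exp (-ρ / 2)) := by
  have := S.prob
  obtain ⟨N, hN1, hD⟩ := S.lemD
  have hN0 : (0 : ℝ) < N := by exact_mod_cast hN1
  set ε := min (1 / (16 * N : ℝ)) (1 / (K.toReal + 1)) with hε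
  have hε0 : 0 < ε := lt_min (by positivity) (by positivity)
  obtain ⟨Mz, hMz, htail⟩ := S.tail N hε0
  refine ⟨N, hN1, Mz, hMz, 1 / (2 * Mz ^ 2), by positivity, htail.le.trans (min_le_left _ _), ?_⟩
  set ρ := 1 / (2 * Mz ^ 2) with hρ
  have hρ0 : 0 < ρ := by positivity
  have hρ2 : ρ * Mz ^ 2 = 1 / 2 := by rw [hρ]; field_simp
  have hρ1 : ρ * Mz ≤ 1 := by nlinarith
  intro v hv u hd ν hν
  have := S.Mprob ν hν
  set Z := {x | bs T b N x ≤ Mz} with hZ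
  have hZm : MeasurableSet Z := measurableSet_le (S.bs_meas N) measurable_const
  have hZc : Zᶜ = {x | Mz < bs T b N x} := by ext x; simp [hZ]
  set Y : α → ℝ := fun x => Real.log (dl (cocycleIter T A N x v) (cocycleIter T A N x u)) - Real.log (dl v u) with hY
  have hYint : Integrable Y ν := S.log_int N hd hν
  have hYm : Measurable Y := (S.dl_meas N v u).log.sub measurable_const
  have hYb : ∀ x, |Y x| ≤ bs T b N x := fun x => S.dl_log N x hd
  have h2 : 2 ≤ ∫ x, Y x ∂ν := hD v hv u hd ν hν
  have hsplit := integral_add_compl hZm hYint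
  have hZcY : ∫ x in Zᶜ, Y x ∂ν ≤ 1 := by
    have hi : Integrable (Zᶜ.indicator (fun x => bs T b N x + 1 / 2)) μ :=
      ((S.bs_int N).add (integrable_const _)).indicator hZm.compl
    calc ∫ x in Zᶜ, Y x ∂ν = ∫ x, Zᶜ.indicator Y x ∂ν := (integral_indicator hZm.compl).symm
      _ ≤ ∫ x, Zᶜ.indicator (fun x => bs T b N x + 1 / 2) x ∂ν := by
          apply integral_mono (hYint.indicator hZm.compl) (S.int_M hν hi)
          intro x
          apply Set.indicator_le_indicator
          have := (abs_le.mp (hYb x)).2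
          linarith
      _ ≤ ∫ x, Zᶜ.indicator (fun x => bs T b N x + 1 / 2) x ∂(K • μ) := by
          apply integral_mono_measure (S.Mle ν hν)
          · refine Eventually.of_forall fun x => Set.indicator_nonneg (fun x _ => ?_) x
            have := S.bs_nn N x
            linarith
          · exact hi.smul_measure S.Kne
      _ = K.toReal * ∫ x, Zᶜ.indicator (fun x => bs T b N x + 1 / 2) x ∂μ := by
          rw [integral_smul_measure]; rfl
      _ ≤ K.toReal * (1 / (K.toReal + 1)) := by
          rw [hZc]
          apply mul_le_mul_of_nonneg_left _ ENNReal.toReal_nonneg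
          exact htail.le.trans (min_le_right _ _)
      _ ≤ 1 := by
          have : 0 ≤ K.toReal := ENNReal.toReal_nonneg
          rw [mul_one_div, div_le_one (by positivity)]; linarith
  have hZY : 1 ≤ ∫ x in Z, Y x ∂ν := by linarith
  have hYZ : ∀ x ∈ Z, |Y x| ≤ Mz := fun x hx => (hYb x).trans hx
  have hexpb : ∀ x ∈ Z, Real.exp (-ρ * Y x) ≤ 1 - ρ * Y x + ρ / 2 := by
    intro x hx
    have h1 := hYZ x hx
    have h3 : |-ρ * Y x| ≤ 1 := by
      rw [abs_mul, abs_neg, abs_of_pos hρ0]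
      exact (mul_le_mul_of_nonneg_left h1 hρ0.le).trans hρ1
    have h4 := exp_quad h3
    have h5 : Y x ^ 2 ≤ Mz ^ 2 := sq_le_sq' (by linarith [(abs_le.mp h1).1]) (abs_le.mp h1).2
    have h6 : (-ρ * Y x) ^ 2 ≤ ρ / 2 := by
      calc (-ρ * Y x) ^ 2 = ρ * (ρ * Y x ^ 2) := by ring
        _ ≤ ρ * (ρ * Mz ^ 2) := by gcongr
        _ = _ := by rw [hρ2]; ring
    linarith
  have hexpint : IntegrableOn (fun x => Real.exp (-ρ * Y x)) Z ν := by
    apply Measure.integrableOn_of_bounded (M := Real.exp 1) (measure_ne_top _ _)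
    · exact ((hYm.const_mul _).exp).aestronglyMeasurable
    · rw [ae_restrict_iff' hZm]
      refine Eventually.of_forall fun x hx => ?_
      rw [Real.norm_eq_abs, abs_of_pos (Real.exp_pos _)]
      apply Real.exp_le_exp.mpr
      have h1 := hYZ x hx
      have h3 : |-ρ * Y x| ≤ 1 := by
        rw [abs_mul, abs_neg, abs_of_pos hρ0]
        exact (mul_le_mul_of_nonneg_left h1 hρ0.le).trans hρ1
      exact (abs_le.mp h3).2
  have hreal : ∫ x in Z, Real.exp (-ρ * Y x) ∂ν ≤ ν.real Z * Real.exp (-ρ / 2) := by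
    have hz1 : ν.real Z ≤ 1 := measureReal_le_one
    have hz0 : 0 ≤ ν.real Z := measureReal_nonneg
    calc ∫ x in Z, Real.exp (-ρ * Y x) ∂ν ≤ ∫ x in Z, ((1 + ρ / 2) - ρ * Y x) ∂ν := by
          apply setIntegral_mono_on hexpint _ hZm
          · intro x hx
            have := hexpb x hx
            linarith
          · exact ((integrable_const _).sub (hYint.const_mul ρ)).integrableOn
      _ = ν.real Z * (1 + ρ / 2) - ρ * ∫ x in Z, Y x ∂ν := by
          rw [integral_sub (integrable_const _) ((hYint.const_mul ρ).integrableOn), setIntegral_const,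
            integral_const_mul, smul_eq_mul]
      _ ≤ ν.real Z * (1 - ρ / 2) := by
          have : ρ * 1 ≤ ρ * ∫ x in Z, Y x ∂ν := by gcongr
          nlinarith
      _ ≤ _ := by
          gcongr
          have := Real.add_one_le_exp (-ρ / 2)
          linarith
  have hdl : ∀ x, dl (cocycleIter T A N x v) (cocycleIter T A N x u) ^ (-ρ) = dl v u ^ (-ρ) * Real.exp (-ρ * Y x) := by
    intro x
    have h0 := dl_pos_map hd (cocycleIter T A N x)
    rw [Real.rpow_def_of_pos h0, Real.rpow_def_of_pos hd, ← Real.exp_add]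
    congr 1; simp only [hY]; ring
  have hd0 : 0 ≤ dl v u ^ (-ρ) := Real.rpow_nonneg hd.le _
  calc _ = ∫⁻ x in Z, ENNReal.ofReal (dl v u ^ (-ρ)) * ENNReal.ofReal (Real.exp (-ρ * Y x)) ∂ν := by
        apply lintegral_congr; intro x
        rw [hdl, ENNReal.ofReal_mul hd0]
    _ = ENNReal.ofReal (dl v u ^ (-ρ)) * ENNReal.ofReal (∫ x in Z, Real.exp (-ρ * Y x) ∂ν) := by
        rw [lintegral_const_mul' _ _ ENNReal.ofReal_ne_top,
          ofReal_integral_eq_lintegral_ofReal hexpint (Eventually.of_forall fun x => (Real.exp_pos _).le)]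
    _ ≤ ENNReal.ofReal (dl v u ^ (-ρ)) * ENNReal.ofReal (ν.real Z * Real.exp (-ρ / 2)) := by
        gcongr
    _ = _ := by
        rw [ENNReal.ofReal_mul measureReal_nonneg, ENNReal.ofReal_mul hd0, ofReal_measureReal]
        ring

end Sys

/-- The logarithmic one-step loss. -/
noncomputable def sfun (p : ℕ) (ρ δ Mz β : ℝ) : ℝ :=
  if β ≤ Mz then -ρ / 2 else ρ * β + Real.log (1 + (2 * δ) ^ ρ * (5 * Real.exp β) ^ p)

/-- Sums of the one-step loss. -/
noncomputable def Ssum (T : α → α) (s : α → ℝ) (N m : ℕ) (x : α) : ℝ :=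
  ∑ k ∈ Finset.range m, s (T^[k * N] x)

theorem Ssum_succ (T : α → α) (s : α → ℝ) (N m : ℕ) (x : α) :
    Ssum T s N (m + 1) x = s x + Ssum T s N m (T^[N] x) := by
  unfold Ssum
  rw [Finset.sum_range_succ', add_comm]
  congr 1
  · simp
  · apply Finset.sum_congr rfl
    intro k _
    rw [← Function.iterate_add_apply]; congr 2; ring

theorem log_bd {p : ℕ} {ρ δ β : ℝ} (hρ : 0 < ρ) (hδ0 : 0 < δ) (hδ : δ ≤ 1 / 10) (hβ : 0 ≤ β) :
    0 ≤ Real.log (1 + (2 * δ) ^ ρ * (5 * Real.exp β) ^ p) ∧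
    Real.log (1 + (2 * δ) ^ ρ * (5 * Real.exp β) ^ p) ≤ Real.log 2 + p * (Real.log 5 + β) := by
  have h1 : (2 * δ) ^ ρ ≤ 1 := Real.rpow_le_one (by positivity) (by linarith) hρ.le
  have h0 : 0 ≤ (2 * δ) ^ ρ := Real.rpow_nonneg (by positivity) _
  have he : 1 ≤ Real.exp β := Real.one_le_exp hβ
  have h2 : 1 ≤ (5 * Real.exp β) ^ p := one_le_pow₀ (by linarith)
  constructor
  · apply Real.log_nonneg
    have : 0 ≤ (2 * δ) ^ ρ * (5 * Real.exp β) ^ p := by positivity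
    linarith
  · have : Real.log 2 + p * (Real.log 5 + β) = Real.log (2 * (5 * Real.exp β) ^ p) := by
      rw [Real.log_mul (by norm_num) (by positivity), Real.log_pow, Real.log_mul (by norm_num) (by positivity), Real.log_exp]
    rw [this]
    apply Real.log_le_log (by positivity)
    nlinarith

namespace Sys

theorem delta_exists (S : Sys μ T A b Θ K M P) (N : ℕ) {Mz ρ ε : ℝ} (hρ : 0 < ρ) (hε : 0 < ε) :
    ∃ δ > 0, δ ≤ 1 / 10 ∧ Real.exp Mz * δ + δ < 1 ∧
      ∫ x, Real.log (1 + (2 * δ) ^ ρ * (5 * Real.exp (bs T b N x)) ^ p) ∂μ < ε := by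
  have := S.prob
  set d : ℕ → ℝ := fun n => 1 / 10 * (1 / ((n : ℝ) + 1)) with hd
  have hd0 : ∀ n, 0 < d n := fun n => by positivity
  have hdle : ∀ n, d n ≤ 1 / 10 := fun n => by
    have : 1 / ((n : ℝ) + 1) ≤ 1 := by rw [div_le_one (by positivity)]; linarith [(Nat.cast_nonneg n : (0:ℝ) ≤ n)]
    simp only [hd]; linarith
  have hdlim : Tendsto d atTop (nhds 0) := by
    have := (tendsto_one_div_add_atTop_nhds_zero_nat (𝕜 := ℝ)).const_mul (1 / 10)
    simpa [hd] using this
  have hlim : Tendsto (fun n : ℕ => ∫ x, Real.log (1 + (2 * d n) ^ ρ * (5 * Real.exp (bs T b N x)) ^ p) ∂μ)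
      atTop (nhds (∫ x, (0 : ℝ) ∂μ)) := by
    apply tendsto_integral_of_dominated_convergence (fun x => Real.log 2 + p * (Real.log 5 + bs T b N x))
    · intro n
      exact ((((S.bs_meas N).exp.const_mul 5).pow_const p).const_mul _ |>.const_add 1).log.aestronglyMeasurable
    · exact (integrable_const _).add (((integrable_const _).add (S.bs_int N)).const_mul _)
    · intro n
      refine Eventually.of_forall fun x => ?_
      have := log_bd (p := p) hρ (hd0 n) (hdle n) (S.bs_nn N x)
      rw [Real.norm_eq_abs, abs_of_nonneg this.1]; exact this.2
    · refine Eventually.of_forall fun x => ?_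
      have h1 : Tendsto (fun n => (2 * d n) ^ ρ) atTop (nhds ((2 * 0) ^ ρ)) :=
        (hdlim.const_mul 2).rpow_const (Or.inr hρ.le)
      rw [mul_zero, Real.zero_rpow hρ.ne'] at h1
      have h2 : Tendsto (fun n => 1 + (2 * d n) ^ ρ * (5 * Real.exp (bs T b N x)) ^ p) atTop
          (nhds (1 + 0 * (5 * Real.exp (bs T b N x)) ^ p)) := (h1.mul_const _).const_add 1
      rw [zero_mul, add_zero] at h2
      have h3 := h2.log one_ne_zero
      rwa [Real.log_one] at h3
  rw [integral_zero] at hlim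
  have hl2 : Tendsto (fun n => Real.exp Mz * d n + d n) atTop (nhds (Real.exp Mz * 0 + 0)) :=
    (hdlim.const_mul _).add hdlim
  rw [mul_zero, add_zero] at hl2
  obtain ⟨n, hn, hn1⟩ := ((hlim.eventually_lt_const hε).and (hl2.eventually_lt_const one_pos)).exists
  exact ⟨d n, hd0 n, hdle n, hn1, hn⟩

theorem survival (S : Sys μ T A b Θ K M P) {N : ℕ} (hN : 1 ≤ N) {ρ : ℝ} (hρ : 0 < ρ) {s : α → ℝ}
    (hs : Measurable s) {h : α → ℝ} (hh : Integrable h μ) (h0 : ∀ x, 0 ≤ h x) (hsh : ∀ x, s x = h x - ρ / 2)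
    (hI : ∫ x, h x ∂μ ≤ ρ / (8 * N)) : ∀ᵐ x ∂μ, ∀ R : ℝ, ∃ m, Ssum T s N m x < -R := by
  have := S.prob
  have hN0 : (0 : ℝ) < N := by exact_mod_cast hN
  have hSm : ∀ m, Measurable (Ssum T s N m) := fun m =>
    Finset.measurable_fun_sum _ fun k _ => hs.comp (S.Tm.iterate _)
  set E : Set α := {x | ∃ R : ℕ, ∀ m, -(R : ℝ) ≤ Ssum T s N m x} with hE
  set ER : ℕ → Set α := fun R => {x | ∀ m, -(R : ℝ) ≤ Ssum T s N m x} with hER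
  have hEU : E = ⋃ R, ER R := by ext x; simp [hE, hER]
  have hERm : ∀ R, MeasurableSet (ER R) := by
    intro R
    have : ER R = ⋂ m, {x | -(R : ℝ) ≤ Ssum T s N m x} := by ext x; simp [hER]
    rw [this]
    exact MeasurableSet.iInter fun m => measurableSet_le measurable_const (hSm m)
  have hEm : MeasurableSet E := by rw [hEU]; exact MeasurableSet.iUnion hERm
  have hERmono : Monotone ER := by
    intro R R' hR x hx m
    have : (R : ℝ) ≤ R' := by exact_mod_cast hR
    have := hx m
    linarith
  have hSh : ∀ m x, Ssum T s N m x = Ssum T h N m x - m * (ρ / 2) := by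
    intro m x
    simp [Ssum, hsh, Finset.sum_sub_distrib]
  have hhI : ∀ m, ∫⁻ x, ENNReal.ofReal (Ssum T h N m x) ∂μ = m * ENNReal.ofReal (∫ x, h x ∂μ) := by
    intro m
    have hk : ∀ k, AEMeasurable (fun x => ENNReal.ofReal (h (T^[k * N] x))) μ := fun k =>
      ((S.mp.iterate (k * N)).integrable_comp_of_integrable hh).aestronglyMeasurable.aemeasurable.ennreal_ofReal
    calc _ = ∫⁻ x, ∑ k ∈ Finset.range m, ENNReal.ofReal (h (T^[k * N] x)) ∂μ := by
          apply lintegral_congr; intro x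
          exact ENNReal.ofReal_sum_of_nonneg fun k _ => h0 _
      _ = ∑ k ∈ Finset.range m, ∫⁻ x, ENNReal.ofReal (h (T^[k * N] x)) ∂μ :=
          lintegral_finsetSum' _ fun k _ => hk k
      _ = ∑ k ∈ Finset.range m, ENNReal.ofReal (∫ x, h x ∂μ) := by
          apply Finset.sum_congr rfl; intro k _
          rw [S.lint_iter (k * N) (f := fun x => ENNReal.ofReal (h x)) hh.aestronglyMeasurable.aemeasurable.ennreal_ofReal,
            ofReal_integral_eq_lintegral_ofReal hh (Eventually.of_forall h0)]
      _ = _ := by simp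
  have hERle : ∀ R, μ (ER R) ≤ ENNReal.ofReal (1 / (2 * N)) := by
    intro R
    obtain ⟨m, hm⟩ := exists_nat_ge ((4 * R + 1) / ρ)
    rw [div_le_iff₀ hρ] at hm
    have hm0 : (0 : ℝ) < m := by
      by_contra hcon
      have : (m : ℝ) = 0 := le_antisymm (not_lt.mp hcon) (Nat.cast_nonneg m)
      rw [this] at hm
      have : (0 : ℝ) ≤ R := Nat.cast_nonneg R
      linarith
    have hsub : ER R ⊆ {x | ENNReal.ofReal (m * (ρ / 4)) ≤ ENNReal.ofReal (Ssum T h N m x)} := by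
      intro x hx
      apply ENNReal.ofReal_le_ofReal
      have := hx m
      rw [hSh] at this
      linarith
    have hShm : Measurable fun x => ENNReal.ofReal (Ssum T h N m x) := by
      have e : (fun x => Ssum T h N m x) = fun x => Ssum T s N m x + (m : ℝ) * (ρ / 2) := by
        funext x; rw [hSh]; ring
      have h1 : Measurable fun x => Ssum T h N m x := by rw [e]; exact (hSm m).add_const _
      exact h1.ennreal_ofReal
    have hmk := mul_meas_ge_le_lintegral₀ (μ := μ) (f := fun x => ENNReal.ofReal (Ssum T h N m x))
      hShm.aemeasurable (ENNReal.ofReal (m * (ρ / 4)))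
    rw [hhI] at hmk
    have hpos : (0 : ℝ) < m * (ρ / 4) := by positivity
    have h3 : ENNReal.ofReal (m * (ρ / 4)) * μ (ER R) ≤ ENNReal.ofReal (m * (ρ / 4)) * ENNReal.ofReal (1 / (2 * N)) := by
      calc _ ≤ _ := mul_le_mul_right (measure_mono hsub) _
        _ ≤ _ := hmk
        _ = ENNReal.ofReal (m * ∫ x, h x ∂μ) := by
            rw [ENNReal.ofReal_mul (by positivity)]; simp
        _ ≤ ENNReal.ofReal (m * (ρ / 4) * (1 / (2 * N))) := by
            apply ENNReal.ofReal_le_ofReal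
            rw [mul_assoc]
            apply mul_le_mul_of_nonneg_left _ hm0.le
            refine hI.trans (le_of_eq ?_)
            field_simp; norm_num
        _ = _ := ENNReal.ofReal_mul hpos.le
    exact (ENNReal.mul_le_mul_iff_right (ENNReal.ofReal_pos.mpr hpos).ne' ENNReal.ofReal_ne_top).mp h3
  have hEle : μ E ≤ ENNReal.ofReal (1 / (2 * N)) := by
    rw [hEU, hERmono.measure_iUnion]
    exact iSup_le hERle
  have hEinv : ∀ x, T^[N] x ∈ E ↔ x ∈ E := by
    intro x
    constructor
    · rintro ⟨R, hR⟩
      obtain ⟨R', hR'⟩ := exists_nat_ge (R + |s x|)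
      refine ⟨R', fun m => ?_⟩
      have h1 := neg_abs_le (s x)
      cases m with
      | zero =>
        have : (0 : ℝ) ≤ R' := Nat.cast_nonneg _
        simp [Ssum]
      | succ m =>
        rw [Ssum_succ]; have := hR m; linarith
    · rintro ⟨R, hR⟩
      obtain ⟨R', hR'⟩ := exists_nat_ge (R + |s x|)
      refine ⟨R', fun m => ?_⟩
      have h1 := le_abs_self (s x)
      have := hR (m + 1)
      rw [Ssum_succ] at this; linarith
  set F : Set α := ⋃ j ∈ Finset.range N, T^[j] ⁻¹' E with hF
  have hFmem : ∀ x, x ∈ F ↔ ∃ j < N, T^[j] x ∈ E := by intro x; simp [hF]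
  have hFinv : T ⁻¹' F = F := by
    ext x
    rw [Set.mem_preimage, hFmem, hFmem]
    constructor
    · rintro ⟨j, hj, hx⟩
      rw [← Function.iterate_succ_apply] at hx
      by_cases h : j + 1 < N
      · exact ⟨j + 1, h, hx⟩
      · have : j.succ = N := by omega
        rw [this, hEinv] at hx
        exact ⟨0, by omega, hx⟩
    · rintro ⟨j, hj, hx⟩
      cases j with
      | zero =>
        refine ⟨N - 1, by omega, ?_⟩
        rw [← Function.iterate_succ_apply, show (N - 1).succ = N by omega, hEinv]
        exact hx
      | succ j => exact ⟨j, by omega, by rwa [Function.iterate_succ_apply] at hx⟩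
  have hFle : μ F ≤ ENNReal.ofReal (1 / 2) := by
    calc μ F ≤ ∑ j ∈ Finset.range N, μ (T^[j] ⁻¹' E) := measure_biUnion_finset_le _ _
      _ = ∑ j ∈ Finset.range N, μ E := by
          apply Finset.sum_congr rfl; intro j _
          exact (S.mp.iterate j).measure_preimage hEm.nullMeasurableSet
      _ ≤ ∑ j ∈ Finset.range N, ENNReal.ofReal (1 / (2 * N)) := Finset.sum_le_sum fun _ _ => hEle
      _ = ENNReal.ofReal (N * (1 / (2 * N))) := by
          rw [ENNReal.ofReal_mul hN0.le]; simp
      _ = _ := by congr 1; field_simp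
  have hF0 : μ F = 0 := by
    rcases outer_zero_one S.erg hFinv with h | h
    · exact h
    · rw [h, ← ENNReal.ofReal_one, ENNReal.ofReal_le_ofReal_iff (by norm_num)] at hFle
      norm_num at hFle
  rw [measure_eq_zero_iff_ae_notMem] at hF0
  filter_upwards [hF0] with x hx R
  by_contra hcon
  push Not at hcon
  apply hx
  rw [hFmem]
  refine ⟨0, hN, ?_⟩
  obtain ⟨R', hR'⟩ := exists_nat_ge R
  exact ⟨R', fun m => by have := hcon m; simp only [Function.iterate_zero, id]; linarith⟩

end Sys
end

open MeasureTheory Filter Metric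
open scoped BigOperators ENNReal
set_option linter.unusedSectionVars false

theorem lat_zero (p : ℕ) : (0 : EE p) ∈ latticeZ p := fun i => ⟨0, by simp⟩

theorem lat_sub {p : ℕ} {c d : EE p} (hc : c ∈ latticeZ p) (hd : d ∈ latticeZ p) : c - d ∈ latticeZ p := by
  intro i
  obtain ⟨a, ha⟩ := hc i
  obtain ⟨e, he⟩ := hd i
  exact ⟨a - e, by simp [ha, he]⟩

theorem lat_norm {p : ℕ} {c : EE p} (hc : c ∈ latticeZ p) (h0 : c ≠ 0) : 1 ≤ ‖c‖ := by
  have : ∃ i, c i ≠ 0 := by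
    by_contra h
    push Not at h
    exact h0 (by ext i; simpa using h i)
  obtain ⟨i, hi⟩ := this
  obtain ⟨k, hk⟩ := hc i
  have h1 : ‖c i‖ ≤ ‖c‖ := PiLp.norm_apply_le c i
  refine le_trans ?_ h1
  rw [hk] at hi ⊢
  have hk0 : k ≠ 0 := fun h => hi (by simp [h])
  rw [Real.norm_eq_abs]
  exact_mod_cast Int.one_le_abs hk0

theorem lat_near {p : ℕ} {w : EE p} {δ : ℝ} (h : infDist w (latticeZ p) < δ) :
    ∃ c ∈ latticeZ p, ‖w - c‖ < δ := by
  obtain ⟨c, hc, hd⟩ := (infDist_lt_iff ⟨0, lat_zero p⟩).mp h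
  exact ⟨c, hc, by rwa [← dist_eq_norm]⟩

theorem lat_shift {p : ℕ} {w c : EE p} {δ : ℝ} (hc : c ∈ latticeZ p) (h : infDist w (latticeZ p) < δ) :
    infDist (w - c) (latticeZ p) < δ := by
  obtain ⟨d, hd, hwd⟩ := lat_near h
  refine (infDist_le_dist_of_mem (lat_sub hd hc)).trans_lt ?_
  rw [dist_eq_norm]
  simpa using hwd

theorem lat_count (p : ℕ) {B : ℝ} (hB : 1 ≤ B) : ∃ F : Finset (EE p), (F.card : ℝ) ≤ (5 * B) ^ p ∧
    ∀ c ∈ latticeZ p, ‖c‖ ≤ 2 * B → c ∈ F := by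
  classical
  set m : ℕ := ⌊2 * B⌋₊ with hm
  have hmB : (m : ℝ) ≤ 2 * B := Nat.floor_le (by linarith)
  refine ⟨(Fintype.piFinset fun _ : Fin p => Finset.Icc (-(m : ℤ)) m).image
    (fun f => (WithLp.toLp 2 (fun i => (f i : ℝ)) : EE p)), ?_, ?_⟩
  · refine le_trans (Nat.cast_le.mpr Finset.card_image_le) ?_
    rw [Fintype.card_piFinset]
    simp only [Int.card_Icc, Finset.prod_const, Finset.card_univ, Fintype.card_fin]
    have : ((m : ℤ) + 1 - -(m : ℤ)).toNat = 2 * m + 1 := by omega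
    rw [this]
    push_cast
    gcongr
    linarith
  · intro c hc hcn
    choose f hf using hc
    rw [Finset.mem_image]
    refine ⟨f, ?_, ?_⟩
    · rw [Fintype.mem_piFinset]
      intro i
      have h1 : ‖c i‖ ≤ ‖c‖ := PiLp.norm_apply_le c i
      rw [hf i, Real.norm_eq_abs] at h1
      have h2 : ((f i).natAbs : ℝ) ≤ 2 * B := by
        rw [Nat.cast_natAbs]; push_cast; linarith
      have h3 : (f i).natAbs ≤ m := Nat.le_floor h2
      rw [Finset.mem_Icc]; omega
    · ext i; simp [hf i]

section
variable {α : Type*} [MeasurableSpace α] {p : ℕ} {μ : Measure α} {T : α → α}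
    {A : α → (EE p ≃L[ℝ] EE p)} {b : α → ℝ} {Θ : Set (EE p)} {K : ℝ≥0∞}
    {M : Measure α → Prop} {P : (k : ℕ) → (Fin k → ℤ) → Set α}

/-- Points whose orbit keeps some small point of the line close to the lattice. -/
def Dset (T : α → α) (A : α → (EE p ≃L[ℝ] EE p)) (N : ℕ) (δ : ℝ) (v u : EE p) : Set α :=
  {x | ∃ t : ℝ, ‖u + t • v‖ < δ ∧ ∀ k : ℕ, infDist (cocycleIter T A (k * N) x (u + t • v)) (latticeZ p) < δ}

/-- Points of `Dset` whose loss sum reached level `-R` before time `m`. -/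
def Xset (T : α → α) (A : α → (EE p ≃L[ℝ] EE p)) (N : ℕ) (δ : ℝ) (s : α → ℝ) (m : ℕ) (v u : EE p) (R : ℝ) : Set α :=
  {x | x ∈ Dset T A N δ v u ∧ ∃ j ≤ m, Ssum T s N j x ≤ -R}

/-- Admissible lattice translations. -/
def Cset {p : ℕ} (Mz : ℝ) (v u : EE p) (L : EE p ≃L[ℝ] EE p) (β : ℝ) : Set (EE p) :=
  {c | c ∈ latticeZ p ∧ ‖c‖ ≤ 2 * Real.exp β ∧ (β ≤ Mz → c = 0) ∧
    (c ≠ 0 → (2 * Real.exp β)⁻¹ ≤ dl (L v) (L u - c))}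

/-- The union of all admissible translated sets. -/
def XX (T : α → α) (A : α → (EE p ≃L[ℝ] EE p)) (N : ℕ) (δ : ℝ) (s : α → ℝ) (m : ℕ) (Mz : ℝ) (v u : EE p) (R : ℝ)
    (L : EE p ≃L[ℝ] EE p) (β : ℝ) : Set α :=
  ⋃ c ∈ Cset Mz v u L β, Xset T A N δ s m (L v) (L u - c) R

namespace Sys

theorem coc_lat (S : Sys μ T A b Θ K M P) (n : ℕ) (x : α) {c : EE p} (hc : c ∈ latticeZ p) :
    cocycleIter T A n x c ∈ latticeZ p ∧ (cocycleIter T A n x).symm c ∈ latticeZ p := by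
  induction n generalizing x c with
  | zero => exact ⟨hc, hc⟩
  | succ n ih =>
    refine ⟨(ih (T x) (S.latInt x c hc).1).1, ?_⟩
    exact (S.latInt x _ (ih (T x) hc).2).2

theorem incl (S : Sys μ T A b Θ K M P) {N : ℕ} {δ Mz : ℝ} (hδ : δ ≤ 1 / 10)
    (hδM : Real.exp Mz * δ + δ < 1) {v u : EE p} {x : α}
    (hmono : ∀ t : ℝ, ‖t • v‖ ≤ ‖t • cocycleIter T A N x v‖) (hx : x ∈ Dset T A N δ v u) :
    ∃ c ∈ Cset Mz v u (cocycleIter T A N x) (bs T b N x),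
      T^[N] x ∈ Dset T A N δ (cocycleIter T A N x v) (cocycleIter T A N x u - c) := by
  obtain ⟨t, ht, hk⟩ := hx
  set w := u + t • v with hw
  set L := cocycleIter T A N x with hL
  set β := bs T b N x with hβ
  have hδ0 : 0 < δ := lt_of_le_of_lt (norm_nonneg _) ht
  have hβ0 : 0 ≤ β := S.bs_nn N x
  have hB : 1 ≤ Real.exp β := Real.one_le_exp hβ0
  have h1 := hk 1
  rw [one_mul] at h1
  obtain ⟨c, hc, hwc⟩ := lat_near h1
  have hLw : L w - c = L u - c + t • L v := by rw [hw, map_add, map_smul]; abel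
  have hLwn : ‖L w‖ ≤ Real.exp β * δ := (S.ub N x w).trans (by gcongr)
  have hcn : ‖c‖ < Real.exp β * δ + δ := by
    have : ‖c‖ ≤ ‖L w‖ + ‖L w - c‖ := by
      have := norm_sub_le (L w) (L w - c)
      simpa using this
    linarith
  refine ⟨c, ⟨hc, ?_, ?_, ?_⟩, ?_⟩
  · nlinarith
  · intro hM
    by_contra hc0
    have h2 := lat_norm hc hc0
    have h3 : Real.exp β * δ ≤ Real.exp Mz * δ := by gcongr
    linarith
  · intro hc0
    obtain ⟨r, hr⟩ := dl_attain (L v) (L u - c)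
    have hd : dl (L v) (L u - c) < δ := by
      refine (dl_le (L v) (L u - c) t).trans_lt ?_
      rw [← hLw]; exact hwc
    set g := L.symm c with hg
    have hgl : g ∈ latticeZ p := (S.coc_lat N x hc).2
    have hg0 : g ≠ 0 := by simpa [hg] using hc0
    have hLg : L g = c := by simp [hg]
    have h2 : ‖(r - t) • v‖ < 2 * δ := by
      refine (hmono _).trans_lt ?_
      have e : (r - t) • L v = (L u - c + r • L v) - (L w - c) := by rw [hLw, sub_smul]; abel
      rw [e]
      refine (norm_sub_le _ _).trans_lt ?_
      rw [← hr]; linarith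
    have h3 : 1 / 2 ≤ ‖u + r • v - g‖ := by
      have e : g = w + (r - t) • v - (u + r • v - g) := by rw [hw, sub_smul]; abel
      have h4 : ‖g‖ ≤ ‖w‖ + ‖(r - t) • v‖ + ‖u + r • v - g‖ := by
        conv_lhs => rw [e]
        exact (norm_sub_le _ _).trans (add_le_add (norm_add_le _ _) le_rfl)
      have h5 := lat_norm hgl hg0
      linarith
    have h6 := S.lb N x (u + r • v - g)
    have e2 : cocycleIter T A N x (u + r • v - g) = L u - c + r • L v := by
      rw [← hL, map_sub, map_add, map_smul, hLg]; abel
    rw [e2, ← hr] at h6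
    rw [mul_inv, inv_mul_le_iff₀ (by norm_num), inv_le_iff_one_le_mul₀' (Real.exp_pos _)]
    linarith
  · refine ⟨t, ?_, fun k => ?_⟩
    · rw [← hLw]; exact hwc
    · rw [← hLw, map_sub]
      apply lat_shift (S.coc_lat _ _ hc).1
      rw [hL, ← cocycle_add]
      have := hk (k + 1)
      rwa [show (k + 1) * N = N + k * N by ring] at this

theorem real_bd {p : ℕ} {ρ δ β d D : ℝ} (hρ : 0 < ρ) (hd : 0 < d) (hdδ : d ≤ δ)
    (hD : d ≤ Real.exp β * D) :
    D ^ (-ρ) + (5 * Real.exp β) ^ p * (2 * Real.exp β) ^ ρ ≤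
      d ^ (-ρ) * Real.exp (ρ * β + Real.log (1 + (2 * δ) ^ ρ * (5 * Real.exp β) ^ p)) := by
  have hB : 0 < Real.exp β := Real.exp_pos β
  have hδ : 0 < δ := hd.trans_le hdδ
  have hD0 : 0 < D := by
    by_contra h
    have : Real.exp β * D ≤ 0 := mul_nonpos_of_nonneg_of_nonpos hB.le (not_lt.mp h)
    linarith
  have hQ : 0 < 1 + (2 * δ) ^ ρ * (5 * Real.exp β) ^ p := by positivity
  rw [Real.exp_add, Real.exp_log hQ]
  have hBρ : Real.exp (ρ * β) = Real.exp β ^ ρ := by rw [← Real.exp_mul]; ring_nf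
  rw [hBρ]
  have h1 : D ^ (-ρ) ≤ d ^ (-ρ) * Real.exp β ^ ρ := by
    have : d / Real.exp β ≤ D := by rw [div_le_iff₀ hB]; linarith
    have h2 := Real.rpow_le_rpow_of_nonpos (by positivity) this (neg_nonpos.mpr hρ.le)
    refine h2.trans (le_of_eq ?_)
    rw [Real.div_rpow hd.le hB.le, Real.rpow_neg hB.le, div_inv_eq_mul]
  have h2 : (2 * Real.exp β) ^ ρ ≤ d ^ (-ρ) * Real.exp β ^ ρ * (2 * δ) ^ ρ := by
    have h3 : 2 * Real.exp β ≤ d⁻¹ * Real.exp β * (2 * δ) := by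
      have : 1 ≤ d⁻¹ * δ := by rw [inv_mul_eq_div, one_le_div hd]; exact hdδ
      nlinarith
    have h4 := Real.rpow_le_rpow (by positivity) h3 hρ.le
    refine h4.trans (le_of_eq ?_)
    rw [Real.mul_rpow (by positivity) (by positivity), Real.mul_rpow (by positivity) (by positivity),
      Real.inv_rpow hd.le, Real.rpow_neg hd.le]
  have h5 : 0 ≤ (5 * Real.exp β) ^ p := by positivity
  calc _ ≤ d ^ (-ρ) * Real.exp β ^ ρ + (5 * Real.exp β) ^ p * (d ^ (-ρ) * Real.exp β ^ ρ * (2 * δ) ^ ρ) := by gcongr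
    _ = _ := by ring

theorem count {ν : Measure α} {N m : ℕ} {δ ρ Mz R β : ℝ} {s : α → ℝ} {v u : EE p} {L : EE p ≃L[ℝ] EE p}
    (hρ : 0 < ρ) (hβ : 0 ≤ β) (hd : 0 < dl v u) (hdδ : dl v u ≤ δ)
    (hL : dl v u ≤ Real.exp β * dl (L v) (L u))
    (ih : ∀ u', 0 < dl (L v) u' → ν (Xset T A N δ s m (L v) u' (R + sfun p ρ δ Mz β)) ≤
      ENNReal.ofReal (dl (L v) u' ^ (-ρ) * Real.exp (-(R + sfun p ρ δ Mz β)))) :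
    ν (XX T A N δ s m Mz v u (R + sfun p ρ δ Mz β) L β) ≤
      if β ≤ Mz then ENNReal.ofReal (dl (L v) (L u) ^ (-ρ)) * ENNReal.ofReal (Real.exp (-R) * Real.exp (ρ / 2))
      else ENNReal.ofReal (dl v u ^ (-ρ) * Real.exp (-R)) := by
  classical
  have hLu := dl_pos_map hd L
  have hih0 := ih (L u) hLu
  split_ifs with hM
  · have hsub : XX T A N δ s m Mz v u (R + sfun p ρ δ Mz β) L β ⊆
        Xset T A N δ s m (L v) (L u) (R + sfun p ρ δ Mz β) := by
      intro x hx
      simp only [XX, Set.mem_iUnion] at hx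
      obtain ⟨c, hc, hx⟩ := hx
      have := hc.2.2.1 hM
      subst this
      simpa using hx
    refine (measure_mono hsub).trans (hih0.trans (le_of_eq ?_))
    rw [← ENNReal.ofReal_mul (Real.rpow_nonneg hLu.le _), ← Real.exp_add]
    congr 3
    simp only [sfun, hM, if_true]; ring
  · set B := Real.exp β with hB
    have hB1 : 1 ≤ B := Real.one_le_exp hβ
    obtain ⟨F, hFc, hF⟩ := lat_count p hB1
    set s0 := sfun p ρ δ Mz β with hs0
    set W := ENNReal.ofReal ((2 * B) ^ ρ * Real.exp (-(R + s0))) with hW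
    set C := Cset Mz v u L β with hC
    have hsub : XX T A N δ s m Mz v u (R + s0) L β ⊆ Xset T A N δ s m (L v) (L u) (R + s0) ∪
        ⋃ c ∈ F.filter (fun c => c ∈ C ∧ c ≠ 0), Xset T A N δ s m (L v) (L u - c) (R + s0) := by
      intro x hx
      simp only [XX, Set.mem_iUnion] at hx
      obtain ⟨c, hc, hx⟩ := hx
      by_cases hc0 : c = 0
      · left; subst hc0; simpa using hx
      · right
        simp only [Set.mem_iUnion]
        exact ⟨c, Finset.mem_filter.mpr ⟨hF c hc.1 hc.2.1, hc, hc0⟩, hx⟩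
    have hterm : ∀ c ∈ F.filter (fun c => c ∈ C ∧ c ≠ 0), ν (Xset T A N δ s m (L v) (L u - c) (R + s0)) ≤ W := by
      intro c hc
      obtain ⟨-, hcC, hc0⟩ := Finset.mem_filter.mp hc
      have h1 := hcC.2.2.2 hc0
      have h2 : 0 < (2 * B)⁻¹ := by positivity
      refine (ih _ (h2.trans_le h1)).trans ?_
      apply ENNReal.ofReal_le_ofReal
      gcongr
      have := Real.rpow_le_rpow_of_nonpos h2 h1 (neg_nonpos.mpr hρ.le)
      refine this.trans (le_of_eq ?_)
      rw [Real.inv_rpow (by positivity), Real.rpow_neg (by positivity), inv_inv]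
    have hcard : ((F.filter (fun c => c ∈ C ∧ c ≠ 0)).card : ℝ≥0∞) ≤ ENNReal.ofReal ((5 * B) ^ p) := by
      have h1 : ((F.filter (fun c => c ∈ C ∧ c ≠ 0)).card : ℝ) ≤ (5 * B) ^ p :=
        le_trans (by exact_mod_cast Finset.card_filter_le _ _) hFc
      have := ENNReal.ofReal_le_ofReal h1
      simpa using this
    have hrb := real_bd (p := p) hρ hd hdδ hL
    calc _ ≤ ν (Xset T A N δ s m (L v) (L u) (R + s0)) +
          ∑ c ∈ F.filter (fun c => c ∈ C ∧ c ≠ 0), ν (Xset T A N δ s m (L v) (L u - c) (R + s0)) :=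
          (measure_mono hsub).trans ((measure_union_le _ _).trans
            (add_le_add le_rfl (measure_biUnion_finset_le _ _)))
      _ ≤ ENNReal.ofReal (dl (L v) (L u) ^ (-ρ) * Real.exp (-(R + s0))) + ENNReal.ofReal ((5 * B) ^ p) * W := by
          apply add_le_add hih0
          refine (Finset.sum_le_sum hterm).trans ?_
          rw [Finset.sum_const, nsmul_eq_mul]
          gcongr
      _ = ENNReal.ofReal ((dl (L v) (L u) ^ (-ρ) + (5 * B) ^ p * (2 * B) ^ ρ) * Real.exp (-(R + s0))) := by
          have : 0 ≤ dl (L v) (L u) ^ (-ρ) := Real.rpow_nonneg hLu.le _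
          rw [hW, ← ENNReal.ofReal_mul (by positivity), ← ENNReal.ofReal_add (by positivity) (by positivity)]
          congr 1; ring
      _ ≤ ENNReal.ofReal (dl v u ^ (-ρ) * Real.exp (-R)) := by
          apply ENNReal.ofReal_le_ofReal
          have e : s0 = ρ * β + Real.log (1 + (2 * δ) ^ ρ * (5 * Real.exp β) ^ p) := by
            simp only [hs0, sfun, hM, if_false]
          rw [← e] at hrb
          calc _ ≤ dl v u ^ (-ρ) * Real.exp s0 * Real.exp (-(R + s0)) := by gcongr
            _ = _ := by rw [mul_assoc, ← Real.exp_add]; congr 2; ring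

theorem claim (S : Sys μ T A b Θ K M P) {N : ℕ} {Mz ρ δ : ℝ} (hρ : 0 < ρ)
    (hδ : δ ≤ 1 / 10) (hδM : Real.exp Mz * δ + δ < 1)
    (hone : ∀ v ∈ cone Θ, ∀ u, 0 < dl v u → ∀ ν, M ν →
      ∫⁻ x in {x | bs T b N x ≤ Mz},
        ENNReal.ofReal (dl (cocycleIter T A N x v) (cocycleIter T A N x u) ^ (-ρ)) ∂ν ≤
      ν {x | bs T b N x ≤ Mz} * ENNReal.ofReal (dl v u ^ (-ρ) * Real.exp (-ρ / 2)))
    (m : ℕ) : ∀ v ∈ cone Θ, ∀ u, 0 < dl v u → ∀ R : ℝ, ∀ ν, M ν →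
      ν (Xset T A N δ (fun x => sfun p ρ δ Mz (bs T b N x)) m v u R) ≤
        ENNReal.ofReal (dl v u ^ (-ρ) * Real.exp (-R)) := by
  set s : α → ℝ := fun x => sfun p ρ δ Mz (bs T b N x) with hs
  induction m with
  | zero =>
    intro v hv u hd R ν hν
    have := S.Mprob ν hν
    by_cases hdδ : δ ≤ dl v u
    · have : Xset T A N δ s 0 v u R = ∅ := by
        rw [Set.eq_empty_iff_forall_notMem]
        rintro x ⟨⟨t, ht, -⟩, -⟩
        have := dl_le v u t
        linarith
      rw [this]; simp
    push Not at hdδ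
    by_cases hR : R ≤ 0
    · refine prob_le_one.trans ?_
      rw [← ENNReal.ofReal_one]
      apply ENNReal.ofReal_le_ofReal
      have h1 : 1 ≤ dl v u ^ (-ρ) := Real.one_le_rpow_of_pos_of_le_one_of_nonpos hd (by linarith) (by linarith)
      have h2 : 1 ≤ Real.exp (-R) := Real.one_le_exp (by linarith)
      exact one_le_mul_of_one_le_of_one_le h1 h2
    · have : Xset T A N δ s 0 v u R = ∅ := by
        rw [Set.eq_empty_iff_forall_notMem]
        rintro x ⟨-, j, hj, hjR⟩
        obtain rfl : j = 0 := by omega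
        simp [Ssum] at hjR
        linarith
      rw [this]; simp
  | succ m ih =>
    intro v hv u hd R ν hν
    have := S.Mprob ν hν
    by_cases hdδ : δ ≤ dl v u
    · have : Xset T A N δ s (m + 1) v u R = ∅ := by
        rw [Set.eq_empty_iff_forall_notMem]
        rintro x ⟨⟨t, ht, -⟩, -⟩
        have := dl_le v u t
        linarith
      rw [this]; simp
    push Not at hdδ
    by_cases hR : R ≤ 0
    · refine prob_le_one.trans ?_
      rw [← ENNReal.ofReal_one]
      apply ENNReal.ofReal_le_ofReal
      have h1 : 1 ≤ dl v u ^ (-ρ) := Real.one_le_rpow_of_pos_of_le_one_of_nonpos hd (by linarith) (by linarith)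
      have h2 : 1 ≤ Real.exp (-R) := Real.one_le_exp (by linarith)
      exact one_le_mul_of_one_le_of_one_le h1 h2
    push Not at hR
    set X : α → Set α := fun x => XX T A N δ s m Mz v u (R + sfun p ρ δ Mz (bs T b N x))
      (cocycleIter T A N x) (bs T b N x) with hX
    set Z := {x | bs T b N x ≤ Mz} with hZ
    have hZm : MeasurableSet Z := measurableSet_le (S.bs_meas N) measurable_const
    set G : α → ℝ≥0∞ := fun x => if bs T b N x ≤ Mz then
        ENNReal.ofReal (dl (cocycleIter T A N x v) (cocycleIter T A N x u) ^ (-ρ)) *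
          ENNReal.ofReal (Real.exp (-R) * Real.exp (ρ / 2))
      else ENNReal.ofReal (dl v u ^ (-ρ) * Real.exp (-R)) with hG
    have hincl : ∀ᵐ x ∂ν, x ∈ Xset T A N δ s (m + 1) v u R → x ∈ {x | T^[N] x ∈ X x} := by
      filter_upwards [S.ac hν S.ae_mono] with x hx hmem
      obtain ⟨hD, j, hj, hjR⟩ := hmem
      have hmono : ∀ t : ℝ, ‖t • v‖ ≤ ‖t • cocycleIter T A N x v‖ := by
        intro t
        rw [norm_smul, norm_smul]
        gcongr
        have := (hx 0 v hv).1 (Nat.zero_le N)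
        simpa [cocycle_zero] using this
      obtain ⟨c, hc, hcD⟩ := S.incl hδ hδM hmono hD
      show T^[N] x ∈ XX _ _ _ _ _ _ _ _ _ _ _ _
      simp only [XX, Set.mem_iUnion]
      refine ⟨c, hc, hcD, ?_⟩
      cases j with
      | zero => simp [Ssum] at hjR; linarith
      | succ j =>
        refine ⟨j, by omega, ?_⟩
        rw [Ssum_succ] at hjR
        simp only [hs] at hjR ⊢
        linarith
    have hdec : ν {x | T^[N] x ∈ X x} ≤ ∫⁻ x, G x ∂ν := by
      apply S.dec_set hν N X G
      · intro f x hx y hy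
        simp only [hX]
        rw [cocycle_congr T A N x y (S.PA N f x hx y hy), bs_congr T b N x y (S.Pb N f x hx y hy)]
      · refine Eventually.of_forall fun x ν' hν' => ?_
        exact count hρ (S.bs_nn N x) hd hdδ.le (S.dl_lower N x v u)
          (fun u' hu' => ih _ (S.cone_coc N x hv) u' hu' _ ν' hν')
    refine (measure_mono_ae hincl).trans (hdec.trans ?_)
    rw [← lintegral_add_compl G hZm]
    have h1 : ∫⁻ x in Z, G x ∂ν ≤ ν Z * ENNReal.ofReal (dl v u ^ (-ρ) * Real.exp (-R)) := by
      have e : ∫⁻ x in Z, G x ∂ν = ∫⁻ x in Z, ENNReal.ofReal (dl (cocycleIter T A N x v) (cocycleIter T A N x u) ^ (-ρ)) *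
          ENNReal.ofReal (Real.exp (-R) * Real.exp (ρ / 2)) ∂ν := by
        apply setLIntegral_congr_fun hZm
        intro x hx
        have hx' : bs T b N x ≤ Mz := hx
        simp only [hG, hx', if_true]
      rw [e, lintegral_mul_const' _ _ ENNReal.ofReal_ne_top]
      calc _ ≤ ν Z * ENNReal.ofReal (dl v u ^ (-ρ) * Real.exp (-ρ / 2)) * ENNReal.ofReal (Real.exp (-R) * Real.exp (ρ / 2)) := by
            gcongr; exact hone v hv u hd ν hν
        _ = _ := by
            have : 0 ≤ dl v u ^ (-ρ) := Real.rpow_nonneg hd.le _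
            rw [mul_assoc, ← ENNReal.ofReal_mul (by positivity)]
            congr 2
            rw [← Real.exp_add, mul_assoc, ← Real.exp_add]; congr 2; ring
    have h2 : ∫⁻ x in Zᶜ, G x ∂ν = ν Zᶜ * ENNReal.ofReal (dl v u ^ (-ρ) * Real.exp (-R)) := by
      rw [mul_comm, ← setLIntegral_const]
      apply setLIntegral_congr_fun hZm.compl
      intro x hx
      have hx' : ¬ bs T b N x ≤ Mz := hx
      simp only [hG, hx', if_false]
    calc _ ≤ ν Z * ENNReal.ofReal (dl v u ^ (-ρ) * Real.exp (-R)) + ν Zᶜ * ENNReal.ofReal (dl v u ^ (-ρ) * Real.exp (-R)) :=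
          add_le_add h1 h2.le
      _ = _ := by rw [← add_mul, measure_add_measure_compl hZm, measure_univ, one_mul]

theorem Dnull (S : Sys μ T A b Θ K M P) : ∃ N : ℕ, 1 ≤ N ∧ ∃ δ > 0, δ ≤ 1 / 10 ∧
    ∀ v ∈ cone Θ, ∀ u, 0 < dl v u → μ (Dset T A N δ v u) = 0 := by
  have := S.prob
  obtain ⟨N, hN, Mz, hMz, ρ, hρ, htail, hone⟩ := S.one_step
  have hN0 : (0 : ℝ) < N := by exact_mod_cast hN
  obtain ⟨δ, hδ0, hδ, hδM, hlog⟩ := S.delta_exists (Mz := Mz) N hρ (show 0 < ρ / (16 * N) by positivity)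
  refine ⟨N, hN, δ, hδ0, hδ, fun v hv u hd => ?_⟩
  set s : α → ℝ := fun x => sfun p ρ δ Mz (bs T b N x) with hs
  have hlogm : Measurable fun x => Real.log (1 + (2 * δ) ^ ρ * (5 * Real.exp (bs T b N x)) ^ p) :=
    ((((S.bs_meas N).exp.const_mul 5).pow_const p).const_mul _ |>.const_add 1).log
  have hsm : Measurable s :=
    Measurable.ite (measurableSet_le (S.bs_meas N) measurable_const) measurable_const
      (((S.bs_meas N).const_mul ρ).add hlogm)
  set ind := {x | Mz < bs T b N x}.indicator (fun x => bs T b N x + 1 / 2) with hind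
  set lg : α → ℝ := fun x => Real.log (1 + (2 * δ) ^ ρ * (5 * Real.exp (bs T b N x)) ^ p) with hlg
  have hindint : Integrable ind μ := ((S.bs_int N).add (integrable_const _)).indicator
    (measurableSet_lt measurable_const (S.bs_meas N))
  have hlgint : Integrable lg μ := by
    refine Integrable.mono' (g := fun x => Real.log 2 + p * (Real.log 5 + bs T b N x))
      ((integrable_const _).add (((integrable_const _).add (S.bs_int N)).const_mul _)) hlogm.aestronglyMeasurable ?_
    refine Eventually.of_forall fun x => ?_
    have := log_bd (p := p) hρ hδ0 hδ (S.bs_nn N x)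
    rw [Real.norm_eq_abs, abs_of_nonneg this.1]; exact this.2
  have hh0 : ∀ x, 0 ≤ s x + ρ / 2 ∧ s x + ρ / 2 ≤ ρ * ind x + lg x := by
    intro x
    have h1 := log_bd (p := p) hρ hδ0 hδ (S.bs_nn N x)
    have h2 := S.bs_nn N x
    by_cases hx : bs T b N x ≤ Mz
    · have : ind x = 0 := Set.indicator_of_notMem (by simpa using hx) _
      rw [this]
      simp only [hs, sfun, hx, if_true, hlg]
      constructor <;> linarith [h1.1]
    · have : ind x = bs T b N x + 1 / 2 := Set.indicator_of_mem (by simpa using hx) _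
      rw [this]
      simp only [hs, sfun, hx, if_false, hlg]
      constructor
      · have : 0 ≤ ρ * bs T b N x := by positivity
        linarith [h1.1]
      · linarith
  have hhIntegrable : Integrable (fun x => s x + ρ / 2) μ := by
    refine Integrable.mono' ((hindint.const_mul ρ).add hlgint) (hsm.add_const _).aestronglyMeasurable ?_
    refine Eventually.of_forall fun x => ?_
    rw [Real.norm_eq_abs, abs_of_nonneg (hh0 x).1]; exact (hh0 x).2
  have hhI : ∫ x, (s x + ρ / 2) ∂μ ≤ ρ / (8 * N) := by
    calc _ ≤ ∫ x, (ρ * ind x + lg x) ∂μ := integral_mono hhIntegrable ((hindint.const_mul ρ).add hlgint) fun x => (hh0 x).2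
      _ = ρ * ∫ x, ind x ∂μ + ∫ x, lg x ∂μ := by
          rw [integral_add (hindint.const_mul ρ) hlgint, integral_const_mul]
      _ ≤ ρ * (1 / (16 * N)) + ρ / (16 * N) := by
          apply add_le_add _ hlog.le
          exact mul_le_mul_of_nonneg_left htail hρ.le
      _ = _ := by field_simp; norm_num
  have hsurv := S.survival hN hρ hsm hhIntegrable (fun x => (hh0 x).1) (fun x => by ring) hhI
  have hle : ∀ R : ℕ, μ (Dset T A N δ v u) ≤ ENNReal.ofReal (dl v u ^ (-ρ) * Real.exp (-(R : ℝ))) := by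
    intro R
    have hsub : ∀ᵐ x ∂μ, x ∈ Dset T A N δ v u → x ∈ ⋃ m, Xset T A N δ s m v u R := by
      filter_upwards [hsurv] with x hx hxD
      obtain ⟨m, hm⟩ := hx R
      rw [Set.mem_iUnion]
      exact ⟨m, hxD, m, le_rfl, hm.le⟩
    have hmono : Monotone fun m => Xset T A N δ s m v u R := by
      rintro m m' hmm x ⟨hxD, j, hj, hjR⟩
      exact ⟨hxD, j, hj.trans hmm, hjR⟩
    have hle1 : μ (Dset T A N δ v u) ≤ μ (⋃ m, Xset T A N δ s m v u R) := measure_mono_ae hsub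
    refine hle1.trans ?_
    rw [hmono.measure_iUnion]
    exact iSup_le fun m => S.claim hρ hδ hδM hone m v hv u hd R μ S.Mμ
  have hlim : Tendsto (fun R : ℕ => ENNReal.ofReal (dl v u ^ (-ρ) * Real.exp (-(R : ℝ)))) atTop (nhds 0) := by
    have h1 : Tendsto (fun R : ℕ => dl v u ^ (-ρ) * Real.exp (-(R : ℝ))) atTop (nhds (dl v u ^ (-ρ) * 0)) :=
      (Real.tendsto_exp_neg_atTop_nhds_zero.comp tendsto_natCast_atTop_atTop).const_mul _
    have := ENNReal.tendsto_ofReal h1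
    simpa using this
  exact le_antisymm (ge_of_tendsto' hlim hle) (zero_le)

end Sys
end

open MeasureTheory Filter Metric
open scoped BigOperators ENNReal

theorem lat_countable (p : ℕ) : (latticeZ p).Countable := by
  have : latticeZ p ⊆ Set.range (fun f : Fin p → ℤ => (WithLp.toLp 2 (fun i => (f i : ℝ)) : EE p)) := by
    intro w hw
    choose f hf using hw
    exact ⟨f, by ext i; simp [hf]⟩
  exact (Set.countable_range _).mono this

section
variable {α : Type*} [MeasurableSpace α] {p : ℕ} {μ : Measure α} {T : α → α}
    {A : α → (EE p ≃L[ℝ] EE p)} {b : α → ℝ} {Θ : Set (EE p)} {K : ℝ≥0∞}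
    {M : Measure α → Prop} {P : (k : ℕ) → (Fin k → ℤ) → Set α}
namespace Sys

theorem ae_not_Dset (S : Sys μ T A b Θ K M P) {N : ℕ} {δ : ℝ}
    (hD : ∀ v ∈ cone Θ, ∀ u, 0 < dl v u → μ (Dset T A N δ v u) = 0) {v : EE p} (hv : v ∈ cone Θ) (u : EE p) :
    ∀ᵐ x ∂μ, ∀ n : ℕ, ∀ c ∈ latticeZ p,
      0 < dl (cocycleIter T A n x v) (cocycleIter T A n x u - c) →
      T^[n] x ∉ Dset T A N δ (cocycleIter T A n x v) (cocycleIter T A n x u - c) := by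
  rw [ae_all_iff]; intro n
  have hc : ∀ᵐ x ∂μ, x ∈ ⋃ f, P n f := by
    rw [ae_iff]; exact S.Pcover n
  have hf : ∀ᵐ x ∂μ, ∀ f : Fin n → ℤ, x ∈ P n f → ∀ c ∈ latticeZ p,
      0 < dl (cocycleIter T A n x v) (cocycleIter T A n x u - c) →
      T^[n] x ∉ Dset T A N δ (cocycleIter T A n x v) (cocycleIter T A n x u - c) := by
    rw [ae_all_iff]; intro f
    by_cases hne : (P n f).Nonempty
    · obtain ⟨y, hy⟩ := hne
      have h1 : ∀ᵐ x ∂μ, ∀ c ∈ latticeZ p,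
          0 < dl (cocycleIter T A n y v) (cocycleIter T A n y u - c) →
          T^[n] x ∉ Dset T A N δ (cocycleIter T A n y v) (cocycleIter T A n y u - c) := by
        rw [ae_ball_iff (lat_countable p)]
        intro c hc
        by_cases hd : 0 < dl (cocycleIter T A n y v) (cocycleIter T A n y u - c)
        · have h0 := hD _ (S.cone_coc n y hv) _ hd
          have h2 := (S.mp.iterate n).quasiMeasurePreserving.ae
            (measure_eq_zero_iff_ae_notMem.mp h0)
          filter_upwards [h2] with x hx _ using hx
        · exact Eventually.of_forall fun x h => absurd h hd
      filter_upwards [h1] with x hx hxP c hc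
      rw [cocycle_congr T A n x y (S.PA n f x hxP y hy)]
      exact hx c hc
    · exact Eventually.of_forall fun x hx => absurd ⟨x, hx⟩ hne
  filter_upwards [hc, hf] with x hx hx2
  obtain ⟨f, hf⟩ := Set.mem_iUnion.mp hx
  exact hx2 f hf

theorem final (S : Sys μ T A b Θ K M P) (v : EE p) (hvΘ : v ∈ Θ) (u : EE p) :
    ∀ᵐ x ∂μ, lineDir v u ∩ weakStable T A x ⊆ latticeZ p := by
  obtain ⟨N, hN, δ, hδ, hδ1, hD⟩ := S.Dnull
  have hv : v ∈ cone Θ := ⟨1, one_ne_zero, v, hvΘ, (one_smul _ _).symm⟩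
  filter_upwards [S.ae_not_Dset hD hv u, S.ae_mono] with x hx hmono
  rintro w ⟨⟨t, hw⟩, hws⟩
  by_contra hwl
  have hev : ∀ᶠ n in atTop, infDist (cocycleIter T A n x w) (latticeZ p) < δ :=
    hws.eventually (gt_mem_nhds hδ)
  obtain ⟨n, hn⟩ := eventually_atTop.mp hev
  -- the key alignment property
  have key : ∀ m, n ≤ m → ∀ c ∈ latticeZ p, ‖cocycleIter T A m x w - c‖ < δ →
      ∃ s : ℝ, cocycleIter T A m x w - c = s • cocycleIter T A m x v := by
    intro m hm c hc hcd
    have hw2 : cocycleIter T A m x u - c + t • cocycleIter T A m x v = cocycleIter T A m x w - c := by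
      rw [hw, map_add, map_smul]; abel
    have hmem : T^[m] x ∈ Dset T A N δ (cocycleIter T A m x v) (cocycleIter T A m x u - c) := by
      refine ⟨t, by rwa [hw2], fun k => ?_⟩
      rw [hw2, map_sub, ← cocycle_add]
      exact lat_shift (S.coc_lat _ _ hc).1 (hn _ (by omega))
    have h0 : ¬ 0 < dl (cocycleIter T A m x v) (cocycleIter T A m x u - c) := fun h => hx m c hc h hmem
    have hmem0 : (0 : EE p) ∈ lineDir (cocycleIter T A m x v) (cocycleIter T A m x u - c) := by
      by_contra h
      exact h0 (dl_pos_iff.mpr h)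
    obtain ⟨t', ht'⟩ := hmem0
    refine ⟨t - t', ?_⟩
    rw [← hw2, sub_smul, eq_neg_of_add_eq_zero_left ht'.symm]; abel
  obtain ⟨c, hc, hcd⟩ := lat_near (hn n le_rfl)
  obtain ⟨s, hs⟩ := key n le_rfl c hc hcd
  set w' := cocycleIter T A n x w - c with hw'
  have hs0 : s ≠ 0 := by
    rintro rfl
    rw [zero_smul, hw', sub_eq_zero] at hs
    apply hwl
    have := (S.coc_lat n x hc).2
    rw [← hs] at this
    simpa using this
  have hvn := S.cone_coc n x hv
  have hw'c : w' ∈ cone Θ := by rw [hs]; exact cone_smul hvn hs0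
  obtain ⟨k, hk⟩ := ((hmono n w' hw'c).2.eventually (eventually_gt_atTop δ)).exists
  obtain ⟨c', hc', hcd'⟩ := lat_near (hn (n + k) (by omega))
  obtain ⟨s', hs'⟩ := key (n + k) (by omega) c' hc' hcd'
  set L := cocycleIter T A k (T^[n] x) with hL
  have hwk : cocycleIter T A (n + k) x w = L w' + L c := by
    rw [cocycle_add, ← map_add, hw', sub_add_cancel]
  have hel : c' - L c ∈ latticeZ p := lat_sub hc' (S.coc_lat _ _ hc).1
  have hgl : L.symm (c' - L c) ∈ latticeZ p := (S.coc_lat _ _ hel).2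
  set g := L.symm (c' - L c) with hg
  have hLg : L g = c' - L c := by simp [hg]
  have hdiff : L (w' - g) = cocycleIter T A (n + k) x w - c' := by
    rw [map_sub, hLg, hwk]; abel
  have hg0 : g ≠ 0 := by
    intro h0
    rw [h0, sub_zero] at hdiff
    rw [← hdiff] at hcd'
    linarith
  have hpar : w' - g = s' • cocycleIter T A n x v := by
    apply L.injective
    rw [hdiff, hs', map_smul, cocycle_add]
  have hsm : ‖w' - g‖ < δ := by
    by_cases h : s' = 0
    · rw [hpar, h, zero_smul, norm_zero]; exact hδ
    · have hm := (hmono n _ (cone_smul hvn h)).1 (Nat.zero_le k)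
      simp only [cocycle_zero] at hm
      rw [← hpar, ← hL, hdiff] at hm
      exact hm.trans_lt hcd'
  have h1 := lat_norm hgl hg0
  have h2 : ‖g‖ ≤ ‖w'‖ + ‖w' - g‖ := by
    have := norm_sub_le w' (w' - g)
    simpa using this
  linarith

end Sys
end

open MeasureTheory Filter Metric
open scoped BigOperators ENNReal

section
variable {α : Type*} [MeasurableSpace α] {p : ℕ}

theorem cyl_meas {T : α → α} (hT : Measurable T) {Δl : ℤ → Set α} (hm : ∀ l, MeasurableSet (Δl l)) (ℓ : List ℤ) :
    MeasurableSet (cylinder T Δl ℓ) := by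
  have : cylinder T Δl ℓ = ⋂ k : Fin ℓ.length, T^[(k : ℕ)] ⁻¹' Δl (ℓ.get k) := by
    ext x; simp [_root_.cylinder]
  rw [this]
  exact MeasurableSet.iInter fun k => (hT.iterate _) (hm _)

theorem cyl_mem {T : α → α} {Δl : ℤ → Set α} (ℓ : List ℤ) (x : α) :
    x ∈ cylinder T Δl ℓ ↔ ∀ k (h : k < ℓ.length), T^[k] x ∈ Δl (ℓ[k]) :=
  ⟨fun h k hk => h ⟨k, hk⟩, fun h k => h k.1 k.2⟩

theorem cyl_ofFn {T : α → α} {Δl : ℤ → Set α} {k : ℕ} (f : Fin k → ℤ) (x : α) :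
    x ∈ cylinder T Δl (List.ofFn f) ↔ ∀ j : Fin k, T^[(j : ℕ)] x ∈ Δl (f j) := by
  rw [cyl_mem]
  constructor
  · intro h j
    have := h j.1 (by simp)
    simpa using this
  · intro h j hj
    have := h ⟨j, by simpa using hj⟩
    simpa using this

theorem cyl_append {T : α → α} {Δl : ℤ → Set α} (ℓ ℓ' : List ℤ) :
    cylinder T Δl (ℓ ++ ℓ') = T^[ℓ.length] ⁻¹' cylinder T Δl ℓ' ∩ cylinder T Δl ℓ := by
  ext x
  rw [Set.mem_inter_iff, Set.mem_preimage, cyl_mem, cyl_mem, cyl_mem]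
  constructor
  · intro h
    constructor
    · intro k hk
      have := h (ℓ.length + k) (by simp; omega)
      rw [List.getElem_append_right (by omega)] at this
      rw [← Function.iterate_add_apply, add_comm]
      simpa using this
    · intro k hk
      have := h k (by simp; omega)
      rwa [List.getElem_append_left hk] at this
  · rintro ⟨h1, h2⟩ k hk
    by_cases hkl : k < ℓ.length
    · rw [List.getElem_append_left hkl]; exact h2 k hkl
    · rw [List.getElem_append_right (by omega)]
      have := h1 (k - ℓ.length) (by simp at hk; omega)
      rw [← Function.iterate_add_apply, Nat.sub_add_cancel (by omega)] at this
      exact this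

theorem cyl_nil {T : α → α} {Δl : ℤ → Set α} : cylinder T Δl [] = Set.univ := by
  ext x; simp [cyl_mem]

/-- The normalised pushforward of a cylinder. -/
noncomputable def cylM (μ : Measure α) (T : α → α) (Δl : ℤ → Set α) (ℓ : List ℤ) : Measure α :=
  (μ (cylinder T Δl ℓ))⁻¹ • (μ.restrict (cylinder T Δl ℓ)).map (T^[ℓ.length])

theorem cylM_nil (μ : Measure α) [IsProbabilityMeasure μ] (T : α → α) (Δl : ℤ → Set α) : cylM μ T Δl [] = μ := by
  simp [cylM, cyl_nil, Measure.map_id]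

theorem cylM_prob (μ : Measure α) [IsProbabilityMeasure μ] {T : α → α} (hT : Measurable T) {Δl : ℤ → Set α}
    (ℓ : List ℤ) (h0 : μ (cylinder T Δl ℓ) ≠ 0) : IsProbabilityMeasure (cylM μ T Δl ℓ) := by
  constructor
  rw [cylM, Measure.smul_apply, Measure.map_apply (hT.iterate _) MeasurableSet.univ]
  simp only [Set.preimage_univ, Measure.restrict_apply_univ, smul_eq_mul]
  exact ENNReal.inv_mul_cancel h0 (measure_ne_top _ _)

theorem cylM_step (μ : Measure α) [IsProbabilityMeasure μ] {T : α → α} (hT : Measurable T) {Δl : ℤ → Set α}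
    (hm : ∀ l, MeasurableSet (Δl l))
    (ℓ ℓ' : List ℤ) (h0 : μ (cylinder T Δl (ℓ ++ ℓ')) ≠ 0) :
    ((cylM μ T Δl ℓ).restrict (cylinder T Δl ℓ')).map (T^[ℓ'.length]) =
      cylM μ T Δl ℓ (cylinder T Δl ℓ') • cylM μ T Δl (ℓ ++ ℓ') := by
  have hC := cyl_meas hT hm ℓ'
  have hC1 := cyl_meas hT hm ℓ
  have hpre := (hT.iterate ℓ.length) hC
  have hmass : cylM μ T Δl ℓ (cylinder T Δl ℓ') = (μ (cylinder T Δl ℓ))⁻¹ * μ (cylinder T Δl (ℓ ++ ℓ')) := by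
    rw [cylM, Measure.smul_apply, Measure.map_apply (hT.iterate _) hC, Measure.restrict_apply hpre,
      ← cyl_append, smul_eq_mul]
  rw [hmass]
  unfold cylM
  rw [Measure.restrict_smul, Measure.map_smul, Measure.restrict_map (hT.iterate _) hC,
    Measure.restrict_restrict hpre, ← cyl_append, Measure.map_map (hT.iterate _) (hT.iterate _),
    ← Function.iterate_add, smul_smul, mul_assoc, ENNReal.mul_inv_cancel h0 (measure_ne_top _ _), mul_one,
    List.length_append, add_comm]

theorem norm0_meas {A : α → (EE p ≃L[ℝ] EE p)} (hA : ∀ w, Measurable fun x => A x w) :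
    Measurable fun x => norm0 (A x) := by
  apply measurable_of_Iic
  intro r
  by_cases hr : 0 ≤ r
  · have : (fun x => norm0 (A x)) ⁻¹' Set.Iic r =
        ⋂ n : ℕ, {x | ‖A x (TopologicalSpace.denseSeq (EE p) n)‖ ≤ r * ‖TopologicalSpace.denseSeq (EE p) n‖ ∧
          ‖TopologicalSpace.denseSeq (EE p) n‖ ≤ r * ‖A x (TopologicalSpace.denseSeq (EE p) n)‖} := by
      ext x
      simp only [Set.mem_preimage, Set.mem_Iic, Set.mem_iInter]
      constructor
      · intro h n
        rw [norm0, max_le_iff] at h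
        refine ⟨((A x : EE p →L[ℝ] EE p).le_opNorm _).trans (by gcongr; exact h.1), ?_⟩
        have := ((A x).symm : EE p →L[ℝ] EE p).le_opNorm (A x (TopologicalSpace.denseSeq (EE p) n))
        simp only [ContinuousLinearEquiv.coe_coe, ContinuousLinearEquiv.symm_apply_apply] at this
        exact this.trans (by gcongr; exact h.2)
      · intro h
        have hall : ∀ w, ‖A x w‖ ≤ r * ‖w‖ ∧ ‖w‖ ≤ r * ‖A x w‖ := by
          have hcl : IsClosed {w | ‖A x w‖ ≤ r * ‖w‖ ∧ ‖w‖ ≤ r * ‖A x w‖} := by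
            have hc1 : Continuous fun w : EE p => ‖A x w‖ := (A x).continuous.norm
            exact (isClosed_le hc1 (continuous_norm.const_mul r)).inter
              (isClosed_le continuous_norm (hc1.const_mul r))
          intro w
          have hd := (TopologicalSpace.denseRange_denseSeq (EE p)).closure_range
          have : closure (Set.range (TopologicalSpace.denseSeq (EE p))) ⊆
              {w | ‖A x w‖ ≤ r * ‖w‖ ∧ ‖w‖ ≤ r * ‖A x w‖} :=
            hcl.closure_subset_iff.mpr (by rintro _ ⟨n, rfl⟩; exact h n)
          rw [hd] at this
          exact this (Set.mem_univ w)
        rw [norm0, max_le_iff]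
        refine ⟨ContinuousLinearMap.opNorm_le_bound _ hr fun w => (hall w).1,
          ContinuousLinearMap.opNorm_le_bound _ hr fun w => ?_⟩
        have := (hall ((A x).symm w)).2
        simpa using this
    rw [this]
    refine MeasurableSet.iInter fun n => MeasurableSet.inter ?_ ?_
    · exact measurableSet_le (hA _).norm measurable_const
    · exact measurableSet_le measurable_const ((hA _).norm.const_mul r)
  · have : (fun x => norm0 (A x)) ⁻¹' Set.Iic r = ∅ := by
      ext x
      simp only [Set.mem_preimage, Set.mem_Iic, Set.mem_empty_iff_false, iff_false, not_le]
      exact (not_le.mp hr).trans_le ((norm_nonneg _).trans (le_max_left _ _))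
    rw [this]; exact MeasurableSet.empty

theorem norm0_bd (e : EE p ≃L[ℝ] EE p) (w : EE p) :
    ‖e w‖ ≤ norm0 e * ‖w‖ ∧ ‖w‖ ≤ norm0 e * ‖e w‖ := by
  constructor
  · exact ((e : EE p →L[ℝ] EE p).le_opNorm _).trans (by gcongr; exact le_max_left _ _)
  · have := (e.symm : EE p →L[ℝ] EE p).le_opNorm (e w)
    simp only [ContinuousLinearEquiv.coe_coe, ContinuousLinearEquiv.symm_apply_apply] at this
    exact this.trans (by gcongr; exact le_max_right _ _)

theorem norm0_one {v : EE p} (hv : v ≠ 0) (e : EE p ≃L[ℝ] EE p) : 1 ≤ norm0 e := by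
  have h1 := (norm0_bd e v).1
  have h2 := (norm0_bd e v).2
  have hp : 0 < ‖v‖ := norm_pos_iff.mpr hv
  have h0 : 0 ≤ norm0 e := (norm_nonneg _).trans (le_max_left _ _)
  by_contra hlt
  push Not at hlt
  have h3 : norm0 e * ‖e v‖ ≤ norm0 e * (norm0 e * ‖v‖) := mul_le_mul_of_nonneg_left h1 h0
  have : norm0 e * norm0 e < 1 := by nlinarith
  nlinarith

theorem mkSys (μ : Measure α) [IsProbabilityMeasure μ]
    (T : α → α) (hT : Ergodic T μ)
    (Δl : ℤ → Set α) (hΔlmeas : ∀ l, MeasurableSet (Δl l))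
    (hΔldisj : Pairwise (Function.onFun Disjoint Δl))
    (hΔlcover : μ (Set.univ \ ⋃ l, Δl l) = 0)
    (K : ℝ≥0∞) (hK0 : 0 < K) (hKtop : K < ⊤)
    (hexpanding : ∀ ℓ : List ℤ, ℓ ≠ [] → ∀ s : Set α, MeasurableSet s →
      K⁻¹ * μ s ≤ (μ (cylinder T Δl ℓ))⁻¹ *
          ((μ.restrict (cylinder T Δl ℓ)).map (T^[ℓ.length])) s ∧
        (μ (cylinder T Δl ℓ))⁻¹ *
          ((μ.restrict (cylinder T Δl ℓ)).map (T^[ℓ.length])) s ≤ K * μ s)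
    (A : α → (EE p ≃L[ℝ] EE p))
    (hAmeas : ∀ w : EE p, Measurable fun x => A x w)
    (hloc : ∀ l, ∀ x ∈ Δl l, ∀ y ∈ Δl l, A x = A y)
    (hint : ∀ x, ∀ w ∈ latticeZ p, A x w ∈ latticeZ p ∧ (A x).symm w ∈ latticeZ p)
    (huni : Integrable (fun x => Real.log (norm0 (A x))) μ)
    (Θ : Set (EE p)) (hΘcomp : IsCompact Θ) (hΘ0 : (0 : EE p) ∉ Θ)
    (hΘinv : ∀ x, ∀ v ∈ Θ, ∃ t : ℝ, 0 < t ∧ t • (A x v) ∈ Θ)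
    (hΘexp : ∀ᵐ x ∂μ, ∀ v ∈ Θ, ∀ c : ℝ, c ≠ 0 →
      ‖c • v‖ ≤ ‖A x (c • v)‖ ∧
        Tendsto (fun n : ℕ => ‖cocycleIter T A n x (c • v)‖) atTop atTop)
    (hcs : ∀ v ∈ Θ, ∀ u : EE p, (0 : EE p) ∉ lineDir v u →
      ∀ᵐ x ∂μ, lineDir v u ∩ centralStable T A x = ∅)
    (v₀ : EE p) (hv₀ : v₀ ∈ Θ) :
    Sys μ T A (fun x => Real.log (norm0 (A x))) Θ K (fun ν => ∃ ℓ, ν = cylM μ T Δl ℓ)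
      (fun _ f => cylinder T Δl (List.ofFn f)) := by
  have hTm : Measurable T := hT.measurable
  have hpos : ∀ ℓ, μ (cylinder T Δl ℓ) ≠ 0 := by
    intro ℓ h0
    by_cases hℓ : ℓ = []
    · subst hℓ; rw [cyl_nil] at h0; simp at h0
    · have h := (hexpanding ℓ hℓ Set.univ MeasurableSet.univ).1
      rw [Measure.restrict_eq_zero.mpr h0] at h
      simp only [Measure.map_zero, Measure.coe_zero, Pi.zero_apply, mul_zero, measure_univ, mul_one,
        nonpos_iff_eq_zero, ENNReal.inv_eq_zero] at h
      exact hKtop.ne h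
  have hle : ∀ ℓ, ℓ ≠ [] → cylM μ T Δl ℓ ≤ K • μ := by
    intro ℓ hℓ
    refine Measure.le_iff.mpr fun s hs => ?_
    exact (hexpanding ℓ hℓ s hs).2
  have hprob : ∀ ℓ, IsProbabilityMeasure (cylM μ T Δl ℓ) := fun ℓ => cylM_prob μ hTm ℓ (hpos ℓ)
  have hK1 : 1 ≤ K := by
    have h := hle [0] (by simp) Set.univ
    have h1 := (hprob [0]).measure_univ
    rw [h1] at h
    simpa using h
  have hv0 : v₀ ≠ 0 := fun h => hΘ0 (h ▸ hv₀)
  have hn1 : ∀ x, 1 ≤ norm0 (A x) := fun x => norm0_one hv0 (A x)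
  have hexp : ∀ x, Real.exp (Real.log (norm0 (A x))) = norm0 (A x) := fun x =>
    Real.exp_log (one_pos.trans_le (hn1 x))
  have hPA : ∀ k (f : Fin k → ℤ), ∀ x ∈ cylinder T Δl (List.ofFn f), ∀ y ∈ cylinder T Δl (List.ofFn f),
      ∀ j < k, A (T^[j] x) = A (T^[j] y) := by
    intro k f x hx y hy j hj
    rw [cyl_ofFn] at hx hy
    exact hloc _ _ (hx ⟨j, hj⟩) _ (hy ⟨j, hj⟩)
  refine
    { prob := inferInstance
      erg := hT
      Kne := hKtop.ne
      K0 := hK0.ne'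
      Mμ := ⟨[], (cylM_nil μ T Δl).symm⟩
      Mprob := by rintro ν ⟨ℓ, rfl⟩; exact hprob ℓ
      Mle := ?_
      Pmeas := fun k f => cyl_meas hTm hΔlmeas _
      Pdisj := ?_
      Pcover := ?_
      Mstep := ?_
      PA := hPA
      Pb := fun k f x hx y hy j hj => by
        show Real.log (norm0 (A (T^[j] x))) = Real.log (norm0 (A (T^[j] y)))
        rw [hPA k f x hx y hy j hj]
      Ameas := hAmeas
      bmeas := (norm0_meas hAmeas).log
      bnn := fun x => Real.log_nonneg (hn1 x)
      bint := huni
      bub := fun x w => by rw [hexp]; exact (norm0_bd _ _).1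
      blb := fun x w => by rw [hexp]; exact (norm0_bd _ _).2
      Θcomp := hΘcomp
      Θ0 := hΘ0
      Θinv := hΘinv
      Θexp := hΘexp
      latInt := hint
      hcs := hcs }
  · rintro ν ⟨ℓ, rfl⟩
    by_cases hℓ : ℓ = []
    · subst hℓ
      rw [cylM_nil]
      refine Measure.le_iff.mpr fun s hs => ?_
      rw [Measure.smul_apply, smul_eq_mul]
      exact le_mul_of_one_le_left (zero_le) hK1
    · exact hle ℓ hℓ
  · intro k f g hfg
    refine Set.disjoint_left.mpr fun x hx hy => hfg ?_
    rw [cyl_ofFn] at hx hy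
    funext j
    by_contra hne
    exact Set.disjoint_left.mp (hΔldisj hne) (hx j) (hy j)
  · intro k
    have h1 : ∀ᵐ x ∂μ, x ∈ ⋃ l, Δl l := by
      rw [ae_iff]
      convert hΔlcover using 2
      ext x; simp
    have h2 : ∀ᵐ x ∂μ, ∀ n : ℕ, T^[n] x ∈ ⋃ l, Δl l := by
      rw [ae_all_iff]; intro n
      exact (hT.toMeasurePreserving.iterate n).quasiMeasurePreserving.ae h1
    have h3 : ∀ᵐ x ∂μ, x ∈ ⋃ f : Fin k → ℤ, cylinder T Δl (List.ofFn f) := by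
      filter_upwards [h2] with x hx
      have : ∀ j : Fin k, ∃ l, T^[(j : ℕ)] x ∈ Δl l := fun j => Set.mem_iUnion.mp (hx j)
      choose f hf using this
      exact Set.mem_iUnion.mpr ⟨f, (cyl_ofFn f x).mpr hf⟩
    exact h3
  · rintro ν ⟨ℓ, rfl⟩ k f
    refine ⟨_, ⟨ℓ ++ List.ofFn f, rfl⟩, ?_⟩
    have := cylM_step μ hTm hΔlmeas ℓ (List.ofFn f) (hpos _)
    rwa [List.length_ofFn] at this

end

/-- Theorem (exclusion of the weak-stable space): let `(T,A)` be a locally constant integral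
uniform cocycle (over a strongly expanding ergodic base), and let `Θ` be a compact adapted set
such that every line `J ∈ J(Θ)` avoids `E^{cs}(x)` for almost every `x`.  Then for every line
`L` parallel to some element of `Θ`, `L ∩ W^s(x) ⊆ ℤ^p` for almost every `x`. -/
theorem weak_stable_exclusion
    {α : Type*} [MeasurableSpace α] {p : ℕ}
    (μ : Measure α) [IsProbabilityMeasure μ]
    (T : α → α) (hT : Ergodic T μ)
    -- base partition, onto branches, strong expansion
    (Δl : ℤ → Set α) (hΔlmeas : ∀ l, MeasurableSet (Δl l))
    (hΔlpos : ∀ l, 0 < μ (Δl l))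
    (hΔldisj : Pairwise (Function.onFun Disjoint Δl))
    (hΔlcover : μ (Set.univ \ ⋃ l, Δl l) = 0)
    (hbij : ∀ l, Set.BijOn T (Δl l) Set.univ)
    (K : ℝ≥0∞) (hK0 : 0 < K) (hKtop : K < ⊤)
    (hexpanding : ∀ ℓ : List ℤ, ℓ ≠ [] → ∀ s : Set α, MeasurableSet s →
      K⁻¹ * μ s ≤ (μ (cylinder T Δl ℓ))⁻¹ *
          ((μ.restrict (cylinder T Δl ℓ)).map (T^[ℓ.length])) s ∧
        (μ (cylinder T Δl ℓ))⁻¹ *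
          ((μ.restrict (cylinder T Δl ℓ)).map (T^[ℓ.length])) s ≤ K * μ s)
    -- the cocycle
    (A : α → (EuclideanSpace ℝ (Fin p) ≃L[ℝ] EuclideanSpace ℝ (Fin p)))
    (hAmeas : ∀ w : EuclideanSpace ℝ (Fin p), Measurable fun x => A x w)
    -- locally constant
    (hloc : ∀ l, ∀ x ∈ Δl l, ∀ y ∈ Δl l, A x = A y)
    -- integral: A(x) ∈ GL(p,ℤ)
    (hint : ∀ x, ∀ w ∈ latticeZ p, A x w ∈ latticeZ p ∧ (A x).symm w ∈ latticeZ p)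
    -- uniform: ∫ log ‖A‖₀ dμ < ∞
    (huni : Integrable (fun x => Real.log (norm0 (A x))) μ)
    -- Θ compact adapted set
    (Θ : Set (EuclideanSpace ℝ (Fin p))) (hΘcomp : IsCompact Θ) (hΘ0 : (0 : _) ∉ Θ)
    (hΘinv : ∀ x, ∀ v ∈ Θ, ∃ t : ℝ, 0 < t ∧ t • (A x v) ∈ Θ)
    (hΘexp : ∀ᵐ x ∂μ, ∀ v ∈ Θ, ∀ c : ℝ, c ≠ 0 →
      ‖c • v‖ ≤ ‖A x (c • v)‖ ∧
        Tendsto (fun n : ℕ => ‖cocycleIter T A n x (c • v)‖) atTop atTop)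
    -- every line in J(Θ) avoids the central stable space a.e.
    (hcs : ∀ v ∈ Θ, ∀ u : EuclideanSpace ℝ (Fin p), (0 : _) ∉ lineDir v u →
      ∀ᵐ x ∂μ, lineDir v u ∩ centralStable T A x = ∅) :
    ∀ v ∈ Θ, ∀ u : EuclideanSpace ℝ (Fin p),
      ∀ᵐ x ∂μ, lineDir v u ∩ weakStable T A x ⊆ latticeZ p := by
  intro v hv u
  exact (mkSys μ T hT Δl hΔlmeas hΔldisj hΔlcover K hK0 hKtop hexpanding A hAmeas hloc hint huni
    Θ hΘcomp hΘ0 hΘinv hΘexp hcs v hv).final v hv u
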